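/- arXiv:math/0305369 — 7 statements merged into one kernel-verified Lean document; each statement's English description precedes it below -/
import Mathlib

section
/- Let p be a prime, G an abelian p-group, h ∈ ℕ, and suppose A = {a_s(n_s)}_{s=1}^k is a (d*(G)+p^h)-cover of ℤ. Let c_1,...,c_k ∈ G and m_1,...,m_k ∈ ℤ. Then for every c ∈ G and every rational number α, the number of subsets I ⊆ {1,...,k} satisfying Σ_{s∈I} c_s = c and Σ_{s∈I} m_s/n_s ∈ α + p^h ℤ is not equal to 1. -/
/-- An exponential sum `∑ i, f i * ρ i ^ x` vanishing for all `x : ℕ` has vanishing partial sums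
over the fibres of `ρ`. -/
lemma sum_fiber_eq_zero_of_sum_mul_pow_eq_zero {K ι : Type*} [Field K] [Fintype ι] [DecidableEq K]
    (f ρ : ι → K) (hf : ∀ x : ℕ, ∑ i, f i * ρ i ^ x = 0) (r : K) :
    ∑ i with ρ i = r, f i = 0 := by
  have hpoly : ∀ P : Polynomial K, ∑ i, f i * P.eval (ρ i) = 0 := by
    intro P
    simp_rw [Polynomial.eval_eq_sum_range, Finset.mul_sum]
    rw [Finset.sum_comm]
    refine Finset.sum_eq_zero fun x _ => ?_
    calc ∑ i, f i * (P.coeff x * ρ i ^ x) = P.coeff x * ∑ i, f i * ρ i ^ x := by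
          rw [Finset.mul_sum]; exact Finset.sum_congr rfl fun i _ => by ring
      _ = 0 := by rw [hf, mul_zero]
  have hQ := hpoly (∏ y ∈ (Finset.univ.image ρ).erase r, (Polynomial.X - Polynomial.C y))
  simp only [Polynomial.eval_prod, Polynomial.eval_sub, Polynomial.eval_X,
    Polynomial.eval_C] at hQ
  have hne : ∏ y ∈ (Finset.univ.image ρ).erase r, (r - y) ≠ 0 :=
    Finset.prod_ne_zero_iff.2 fun y hy => sub_ne_zero.2 (Finset.ne_of_mem_erase hy).symm
  refine (mul_eq_zero.1 ?_).resolve_right hne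
  rw [← hQ, Finset.sum_filter, Finset.sum_mul]
  refine Finset.sum_congr rfl fun i _ => ?_
  split_ifs with hi
  · rw [hi]
  · rw [zero_mul, Finset.prod_eq_zero (i := ρ i) (by simp [hi]) (sub_self _), mul_zero]

/-- Weighted sums of monomials of degree less than the covering multiplicity vanish. -/
lemma sum_superset_eq_zero_of_cover {K σ : Type*} [Field K] [DecidableEq K] [Fintype σ]
    [DecidableEq σ] (w ρ : σ → K) (M : ℕ)
    (hM : ∀ x : ℕ, M ≤ (Finset.univ.filter fun s => w s * ρ s ^ x = 1).card)
    (r : K) (J : Finset σ) (hJ : J.card < M) :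
    ∑ I : Finset σ with ∏ s ∈ I, ρ s = r, (if J ⊆ I then ∏ s ∈ I, -w s else 0) = 0 := by
  refine sum_fiber_eq_zero_of_sum_mul_pow_eq_zero
    (fun I : Finset σ => if J ⊆ I then ∏ s ∈ I, -w s else 0) (fun I => ∏ s ∈ I, ρ s) ?_ r
  intro x
  obtain ⟨s, hs, hsJ⟩ := Finset.exists_mem_notMem_of_card_lt_card (hJ.trans_le (hM x))
  have hprod : ∏ s, (-(w s * ρ s ^ x) + if s ∈ J then (0 : K) else 1) = 0 :=
    Finset.prod_eq_zero (Finset.mem_univ s) (by simp [hsJ, (Finset.mem_filter.1 hs).2])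
  rw [Finset.prod_add, Finset.powerset_univ] at hprod
  refine (Finset.sum_congr rfl fun I _ => ?_).trans hprod
  by_cases hI : J ⊆ I
  · have h1 : ∏ s ∈ Finset.univ \ I, (if s ∈ J then (0 : K) else 1) = 1 :=
      Finset.prod_eq_one fun s hs => if_neg fun h => (Finset.mem_sdiff.1 hs).2 (hI h)
    rw [h1, if_pos hI, mul_one, ← Finset.prod_pow, ← Finset.prod_mul_distrib]
    exact Finset.prod_congr rfl fun s _ => by ring
  · obtain ⟨t, htJ, htI⟩ := Finset.not_subset.1 hI
    have h1 : ∏ s ∈ Finset.univ \ I, (if s ∈ J then (0 : K) else 1) = 0 :=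
      Finset.prod_eq_zero (by simpa using htI) (if_pos htJ)
    rw [h1, if_neg hI, zero_mul, mul_zero]

/-- Weighted sums of products of fewer affine forms than the covering multiplicity vanish. -/
lemma sum_prod_affine_eq_zero_of_cover {K σ ι : Type*} [Field K] [DecidableEq K] [Fintype σ]
    [DecidableEq σ] (w ρ : σ → K) (M : ℕ)
    (hM : ∀ x : ℕ, M ≤ (Finset.univ.filter fun s => w s * ρ s ^ x = 1).card)
    (r : K) (b : ι → K) (u : ι → σ → K) (T : Finset ι) (J : Finset σ)
    (hJ : J.card + T.card < M) :
    ∑ I : Finset σ with ∏ s ∈ I, ρ s = r,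
      (if J ⊆ I then ∏ s ∈ I, -w s else 0) * ∏ j ∈ T, (b j + ∑ s ∈ I, u j s) = 0 := by
  classical
  induction T using Finset.induction_on generalizing J with
  | empty => simpa using sum_superset_eq_zero_of_cover w ρ M hM r J (by simpa using hJ)
  | insert j T hj ih =>
    rw [Finset.card_insert_of_notMem hj] at hJ
    have key : ∀ I : Finset σ,
        (if J ⊆ I then ∏ s ∈ I, -w s else 0) * ∏ j ∈ insert j T, (b j + ∑ s ∈ I, u j s) =
        b j * ((if J ⊆ I then ∏ s ∈ I, -w s else 0) * ∏ j ∈ T, (b j + ∑ s ∈ I, u j s)) +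
        ∑ s, u j s * ((if insert s J ⊆ I then ∏ s ∈ I, -w s else 0) *
          ∏ j ∈ T, (b j + ∑ s ∈ I, u j s)) := by
      intro I
      rw [Finset.prod_insert hj]
      have h1 : ∑ s ∈ I, u j s = ∑ s, if s ∈ I then u j s else 0 := by simp
      rw [h1, add_mul, mul_add, Finset.sum_mul, Finset.mul_sum]
      congr 1
      · ring
      · refine Finset.sum_congr rfl fun s _ => ?_
        by_cases hs : s ∈ I <;> by_cases hJI : J ⊆ I <;>
          simp [Finset.insert_subset_iff, hs, hJI]
        ring
    simp_rw [key]
    rw [Finset.sum_add_distrib, ← Finset.mul_sum, ih J (by omega), mul_zero, zero_add,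
      Finset.sum_comm]
    refine Finset.sum_eq_zero fun s _ => ?_
    rw [← Finset.mul_sum, ih _ (by have := Finset.card_insert_le s J; omega), mul_zero]

/-- `binom(x, p ^ h - 1)` modulo `p` detects whether `p ^ h` divides `x + 1`. -/
lemma ringChoose_prime_pow_sub_one_mod (p : ℕ) (hp : p.Prime) (h : ℕ) (x : ℤ) :
    ((Ring.choose x (p ^ h - 1) : ℤ) : ZMod p) = if (p : ℤ) ^ h ∣ x + 1 then 1 else 0 := by
  have hq : 0 < p ^ h := pow_pos hp.pos h
  have hper : Function.Periodic
      (fun y : ℤ => ((Ring.choose y (p ^ h - 1) : ℤ) : ZMod p)) ((p ^ h : ℕ) : ℤ) := by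
    intro y
    simp only
    rw [Ring.add_choose_eq _ (Commute.all _ _), Int.cast_sum,
      Finset.sum_eq_single (p ^ h - 1, 0)]
    · simp
    · rintro ⟨i, j⟩ hij hne
      rw [Finset.HasAntidiagonal.mem_antidiagonal] at hij
      simp only at hij
      have hj : j ≠ 0 := by
        rintro rfl
        exact hne (by simp at hij; simp [hij])
      have hdvd : p ∣ (p ^ h).choose j := hp.dvd_choose_pow hj (by omega)
      simp only [Int.cast_mul, Ring.choose_natCast, Int.cast_natCast]
      rw [(ZMod.natCast_eq_zero_iff _ _).2 hdvd, mul_zero]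
    · simp
  set q : ℕ := p ^ h with hqdef
  have hqc : (p : ℤ) ^ h = (q : ℤ) := by simp [hqdef]
  rw [hqc]
  obtain ⟨y, hy⟩ := Int.eq_ofNat_of_zero_le (Int.emod_nonneg x (b := (q : ℤ)) (by omega))
  have hylt : y < q := by have := Int.emod_lt_of_pos x (b := (q : ℤ)) (by omega); omega
  have hx : x = (y : ℤ) + (x / q) * q := by
    have := Int.emod_add_mul_ediv x q
    rw [hy] at this
    linarith
  have hval := (hper.int_mul (x / q)) (y : ℤ)
  rw [Int.cast_id, ← hx] at hval
  rw [hval, Ring.choose_natCast]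
  have hiff : (q : ℤ) ∣ x + 1 ↔ y = q - 1 := by
    have h2 : (q : ℤ) ∣ x + 1 ↔ (q : ℤ) ∣ ((y + 1 : ℕ) : ℤ) := by
      rw [show x + 1 = ((y + 1 : ℕ) : ℤ) + (x / q) * q by push_cast; linarith]
      exact dvd_add_left (dvd_mul_left _ _)
    rw [h2, Int.natCast_dvd_natCast]
    constructor
    · intro hd
      have := Nat.le_of_dvd (by omega) hd
      omega
    · rintro rfl
      rw [Nat.sub_add_cancel hq]
  split_ifs with hd
  · rw [hiff.1 hd, Nat.choose_self]; simp
  · rw [Nat.choose_eq_zero_of_lt (by have := mt hiff.2 hd; omega)]; simp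

lemma prod_fin_sub_div_eq_ringChoose {K : Type*} [Field K] [CharZero K] (x : ℤ) (r : ℕ) :
    ∏ i : Fin r, (((x : K) - (i : ℕ)) / ((i : ℕ) + 1)) = (Ring.choose x r : ℤ) := by
  rw [Fin.prod_univ_eq_prod_range (fun i : ℕ => ((x : K) - i) / ((i : K) + 1)) r]
  have h1 := Ring.descPochhammer_eq_factorial_smul_choose x r
  rw [← Polynomial.eval_eq_smeval] at h1
  have h2 : ((descPochhammer ℤ r).eval x : ℤ) = ∏ i ∈ Finset.range r, (x - i) :=
    descPochhammer_eval_eq_prod_range r x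
  have h3 : (∏ i ∈ Finset.range r, ((i : K) + 1)) = (r.factorial : K) := by
    rw [← Finset.prod_range_add_one_eq_factorial]; push_cast; rfl
  rw [Finset.prod_div_distrib, h3, div_eq_iff (by exact_mod_cast r.factorial_ne_zero)]
  rw [h2, nsmul_eq_mul] at h1
  have h4 := congrArg (Int.cast (R := K)) h1
  push_cast at h4
  rw [h4, mul_comm]

/-- An integer which is a prime multiple of an algebraic integer is divisible by that prime. -/
lemma dvd_of_intCast_eq_mul_isIntegral (p : ℕ) (hp : p.Prime) (B : ℤ) (y : ℂ)
    (hy : IsIntegral ℤ y) (hB : (B : ℂ) = p * y) : (p : ℤ) ∣ B := by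
  have hp0 : (p : ℚ) ≠ 0 := by exact_mod_cast hp.ne_zero
  have hpc : (p : ℂ) ≠ 0 := by exact_mod_cast hp.ne_zero
  have h1 : y = algebraMap ℚ ℂ ((B : ℚ) / p) := by
    rw [eq_ratCast]; push_cast; rw [hB]; field_simp
  rw [h1, isIntegral_algebraMap_iff (algebraMap ℚ ℂ).injective,
    IsIntegrallyClosed.isIntegral_iff] at hy
  obtain ⟨z, hz⟩ := hy
  refine ⟨z, ?_⟩
  rw [eq_intCast, eq_div_iff hp0] at hz
  have : (B : ℚ) = p * z := by rw [← hz, mul_comm]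
  exact_mod_cast this

/-- The additive character `q ↦ e^{2πiq}` on the rationals. -/
noncomputable def ratExp (q : ℚ) : ℂ := Complex.exp (2 * Real.pi * Complex.I * q)

lemma ratExp_add (x y : ℚ) : ratExp (x + y) = ratExp x * ratExp y := by
  rw [ratExp, ratExp, ratExp, ← Complex.exp_add]; push_cast; ring_nf

lemma ratExp_zero : ratExp 0 = 1 := by simp [ratExp]

lemma ratExp_sum {ι : Type*} (s : Finset ι) (f : ι → ℚ) :
    ratExp (∑ i ∈ s, f i) = ∏ i ∈ s, ratExp (f i) := by
  classical
  induction s using Finset.induction_on with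
  | empty => simp [ratExp_zero]
  | insert i s hi ih => rw [Finset.sum_insert hi, Finset.prod_insert hi, ratExp_add, ih]

lemma ratExp_nat_mul (x : ℕ) (q : ℚ) : ratExp (x * q) = ratExp q ^ x := by
  rw [ratExp, ratExp, ← Complex.exp_nat_mul]; push_cast; ring_nf

lemma ratExp_eq_ratExp_iff (x y : ℚ) : ratExp x = ratExp y ↔ ∃ z : ℤ, x = y + z := by
  rw [ratExp, ratExp, Complex.exp_eq_exp_iff_exists_int]
  refine exists_congr fun z => ?_
  have hpi : (2 * Real.pi * Complex.I : ℂ) ≠ 0 := Complex.two_pi_I_ne_zero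
  rw [show (2 * Real.pi * Complex.I * y + z * (2 * Real.pi * Complex.I) : ℂ) =
    2 * Real.pi * Complex.I * ((y + z : ℚ) : ℂ) by push_cast; ring, mul_right_inj' hpi]
  exact_mod_cast Iff.rfl

lemma ratExp_intCast (z : ℤ) : ratExp z = 1 := by
  rw [← ratExp_zero, ratExp_eq_ratExp_iff]; exact ⟨z, by simp⟩

lemma isIntegral_ratExp (q : ℚ) : IsIntegral ℤ (ratExp q) := by
  refine IsIntegral.of_pow (n := q.den) q.pos ?_
  rw [← ratExp_nat_mul, Rat.den_mul_eq_num, ratExp_intCast]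
  exact isIntegral_one

/-- Divisibility by `p` of an integer appearing in a vanishing sum with unit weights, all of whose
other terms are divisible by `p`. -/
lemma dvd_of_sum_mul_eq_zero {ι : Type*} (p : ℕ) (hp : p.Prime) (S : Finset ι)
    (f : ι → ℂ) (B : ι → ℤ) (hf : ∀ i, IsIntegral ℤ (f i)) (i₀ : ι) (hi₀ : i₀ ∈ S)
    (g : ℂ) (hg : IsIntegral ℤ g) (hgf : g * f i₀ = 1)
    (hsum : ∑ i ∈ S, f i * B i = 0) (hB : ∀ i ∈ S, i ≠ i₀ → (p : ℤ) ∣ B i) :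
    (p : ℤ) ∣ B i₀ := by
  classical
  rw [← Finset.add_sum_erase S _ hi₀] at hsum
  refine dvd_of_intCast_eq_mul_isIntegral p hp (B i₀)
    (-(g * ∑ i ∈ S.erase i₀, f i * ((B i / p : ℤ) : ℂ))) ?_ ?_
  · refine (hg.mul (IsIntegral.sum _ fun i _ => (hf i).mul ?_)).neg
    exact isIntegral_algebraMap (R := ℤ) (A := ℂ) (x := B i / p)
  · have h1 : ∑ i ∈ S.erase i₀, f i * (B i : ℂ) =
        p * ∑ i ∈ S.erase i₀, f i * ((B i / p : ℤ) : ℂ) := by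
      rw [Finset.mul_sum]
      refine Finset.sum_congr rfl fun i hi => ?_
      obtain ⟨hne, hmem⟩ := Finset.mem_erase.1 hi
      have h2 : (B i : ℂ) = p * ((B i / p : ℤ) : ℂ) := by
        exact_mod_cast (Int.mul_ediv_cancel' (hB i hmem hne)).symm
      rw [h2]; ring
    rw [h1] at hsum
    linear_combination g * hsum - (B i₀ : ℂ) * hgf

/-- **Main Theorem (Theorem 2.1), non-uniqueness part.**
Let `p` be a prime and `G = ⨁_t ℤ/p^{hvec t}ℤ` an abelian `p`-group with
`d*(G) = ∑_t (p^{hvec t} - 1)`.  If `{a s (n s)}_{s=1}^k` is a `(d*(G)+p^h)`-cover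
of `ℤ`, then for any `c₁,…,c_k ∈ G`, `m₁,…,m_k ∈ ℤ`, `c ∈ G` and `α ∈ ℚ`, the number
of subsets `I ⊆ {1,…,k}` with `∑_{s∈I} c_s = c` and `∑_{s∈I} m_s/n_s ∈ α + p^h ℤ`
is not equal to `1`. -/
theorem stmt0 (p : ℕ) (hp : p.Prime) (l : ℕ) (hvec : Fin l → ℕ) (h : ℕ)
    (k : ℕ) (a : Fin k → ℤ) (n : Fin k → ℕ) (hn : ∀ s, 0 < n s)
    (hcover : ∀ x : ℤ,
      (∑ t, (p ^ hvec t - 1)) + p ^ h ≤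
        (Finset.univ.filter fun s : Fin k => (n s : ℤ) ∣ x - a s).card)
    (c : Fin k → (∀ t, ZMod (p ^ hvec t))) (m : Fin k → ℤ)
    (c₀ : ∀ t, ZMod (p ^ hvec t)) (α : ℚ) :
    {I : Finset (Fin k) | (∑ s ∈ I, c s) = c₀ ∧
      ∃ z : ℤ, ∑ s ∈ I, (m s : ℚ) / (n s : ℚ) = α + (p : ℚ) ^ h * z}.ncard ≠ 1 := by
  classical
  intro hcard
  obtain ⟨I₀, hI₀⟩ := Set.ncard_eq_one.1 hcard
  have hmem : ∀ I : Finset (Fin k), ((∑ s ∈ I, c s) = c₀ ∧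
      ∃ z : ℤ, ∑ s ∈ I, (m s : ℚ) / (n s : ℚ) = α + (p : ℚ) ^ h * z) ↔ I = I₀ := by
    intro I
    have := Set.ext_iff.1 hI₀ I
    simpa using this
  have : ∀ t, NeZero (p ^ hvec t) := fun t => ⟨(pow_pos hp.pos _).ne'⟩
  have : Fact p.Prime := ⟨hp⟩
  set w : Fin k → ℂ := fun s => ratExp (m s * a s / n s) with hw
  set ρ : Fin k → ℂ := fun s => ratExp (m s / n s) with hρ
  set H : Option (Fin l) → ℕ := fun t => t.elim h hvec with hH
  -- `N t I` is the integer whose divisibility by `p ^ H t` expresses the `t`-th condition on `I`.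
  set v : Option (Fin l) → Fin k → ℚ :=
    fun t s => t.elim ((m s : ℚ) / n s) fun t => ((c s t).val : ℚ) with hv
  set v₀ : Option (Fin l) → ℚ := fun t => t.elim α fun t => ((c₀ t).val : ℚ) with hv₀
  set N : Option (Fin l) → Finset (Fin k) → ℤ := fun t I => ⌊∑ s ∈ I, v t s - v₀ t⌋ with hN
  set B : Finset (Fin k) → ℤ := fun I => ∏ t, Ring.choose (N t I - 1) (p ^ H t - 1) with hBdef
  have hM : ∀ x : ℕ, (∑ t, (p ^ hvec t - 1)) + p ^ h ≤
      (Finset.univ.filter fun s => w s * ρ s ^ x = 1).card := by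
    intro x
    refine (hcover (-x)).trans (Finset.card_le_card ?_)
    intro s hs
    rw [Finset.mem_filter] at hs ⊢
    refine ⟨hs.1, ?_⟩
    obtain ⟨z, hz⟩ := hs.2
    have hns : (n s : ℚ) ≠ 0 := by exact_mod_cast (hn s).ne'
    simp only [hw, hρ]
    rw [← ratExp_nat_mul, ← ratExp_add]
    have hz' : (-x - a s : ℚ) = n s * z := by exact_mod_cast hz
    rw [show (m s * a s / n s + x * (m s / n s) : ℚ) = ((-(m s * z) : ℤ) : ℚ) by
      push_cast; field_simp; linear_combination (-(m s : ℚ)) * hz']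
    exact ratExp_intCast _
  have hρI : ∀ I : Finset (Fin k), ∏ s ∈ I, ρ s = ratExp α ↔
      ∃ z : ℤ, ∑ s ∈ I, (m s : ℚ) / n s = α + z := by
    intro I
    rw [← ratExp_eq_ratExp_iff, ratExp_sum]
  have hcast : ∀ I : Finset (Fin k), ∏ s ∈ I, ρ s = ratExp α → ∀ t,
      ((N t I : ℤ) : ℚ) = ∑ s ∈ I, v t s - v₀ t := by
    intro I hI t
    suffices ∃ z : ℤ, ∑ s ∈ I, v t s - v₀ t = z by
      obtain ⟨z, hz⟩ := this
      simp only [hN]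
      rw [hz, Int.floor_intCast]
    cases t with
    | none =>
      obtain ⟨z, hz⟩ := (hρI I).1 hI
      exact ⟨z, by simp only [hv, hv₀, Option.elim]; rw [hz]; ring⟩
    | some t =>
      exact ⟨∑ s ∈ I, ((c s t).val : ℤ) - (c₀ t).val, by simp [hv, hv₀]⟩
  have hcond : ∀ I : Finset (Fin k), ∏ s ∈ I, ρ s = ratExp α →
      ((∀ t, (p : ℤ) ^ H t ∣ N t I) ↔ I = I₀) := by
    intro I hI
    rw [← hmem I, Option.forall, and_comm]
    refine and_congr ?_ ?_
    · rw [funext_iff]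
      refine forall_congr' fun t => ?_
      have h1 : N (some t) I = ∑ s ∈ I, ((c s t).val : ℤ) - (c₀ t).val := by
        have := hcast I hI (some t)
        simp only [hv, hv₀, Option.elim] at this
        exact_mod_cast this
      have h2 := ZMod.intCast_zmod_eq_zero_iff_dvd (N (some t) I) (p ^ hvec t)
      rw [h1] at h2 ⊢
      simp only [hH, Option.elim]
      push_cast at h2
      rw [← h2, sub_eq_zero]
      simp
    · have h1 := hcast I hI none
      simp only [hv, hv₀, Option.elim] at h1
      simp only [hH, Option.elim]
      refine exists_congr fun z => ?_
      rw [← sub_eq_iff_eq_add', ← h1]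
      exact_mod_cast Iff.rfl
  have hBmod : ∀ I : Finset (Fin k), ∏ s ∈ I, ρ s = ratExp α →
      ((p : ℤ) ∣ B I ↔ I ≠ I₀) := by
    intro I hI
    rw [← ZMod.intCast_zmod_eq_zero_iff_dvd, Ne, ← hcond I hI, hBdef, Int.cast_prod,
      Finset.prod_eq_zero_iff]
    simp [ringChoose_prime_pow_sub_one_mod p hp]
  have hI₀ρ : ∏ s ∈ I₀, ρ s = ratExp α := by
    obtain ⟨-, z, hz⟩ := (hmem I₀).2 rfl
    exact (hρI I₀).2 ⟨p ^ h * z, by rw [hz]; push_cast; rfl⟩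
  have hzero := sum_prod_affine_eq_zero_of_cover w ρ _ hM (ratExp α)
    (fun j : Σ t, Fin (p ^ H t - 1) =>
      (-(v₀ j.1 : ℂ) - 1 - ((j.2 : ℕ) : ℂ)) / (((j.2 : ℕ) : ℂ) + 1))
    (fun j s => (v j.1 s : ℂ) / (((j.2 : ℕ) : ℂ) + 1)) Finset.univ ∅ (by
      have := pow_pos hp.pos h
      simp [hH]
      omega)
  have hsum : ∑ I : Finset (Fin k) with ∏ s ∈ I, ρ s = ratExp α,
      (∏ s ∈ I, -w s) * (B I : ℂ) = 0 := by
    rw [← hzero]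
    refine Finset.sum_congr rfl fun I hI => ?_
    rw [if_pos (Finset.empty_subset I), hBdef, Int.cast_prod, Fintype.prod_sigma]
    congr 1
    refine Finset.prod_congr rfl fun t _ => ?_
    rw [← prod_fin_sub_div_eq_ringChoose]
    refine Finset.prod_congr rfl fun i _ => ?_
    have h1 : ((N t I : ℤ) : ℂ) = ∑ s ∈ I, (v t s : ℂ) - v₀ t := by
      exact_mod_cast congrArg (Rat.cast (K := ℂ)) (hcast I (Finset.mem_filter.1 hI).2 t)
    rw [← Finset.sum_div, ← add_div]
    push_cast
    rw [h1]
    ring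
  refine (hBmod I₀ hI₀ρ).1 (dvd_of_sum_mul_eq_zero p hp _ _ B
    (fun I => IsIntegral.prod _ fun s _ => (isIntegral_ratExp _).neg) I₀
    (Finset.mem_filter.2 ⟨Finset.mem_univ _, hI₀ρ⟩)
    (∏ s ∈ I₀, -ratExp (-(m s * a s / n s)))
    (IsIntegral.prod _ fun s _ => (isIntegral_ratExp _).neg) ?_ hsum
    fun I hI hne => (hBmod I (Finset.mem_filter.1 hI).2).2 hne) rfl
  rw [← Finset.prod_mul_distrib]
  refine Finset.prod_eq_one fun s _ => ?_
  rw [neg_mul_neg, ← ratExp_add, neg_add_cancel, ratExp_zero]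
end

section
/- Let p be a prime, G an abelian p-group, h ∈ ℕ, and suppose A = {a_s(n_s)}_{s=1}^k is a (d*(G)+p^h)-cover of ℤ. Let c_1,...,c_k ∈ G and m_1,...,m_k ∈ ℤ. Then there exists a nonempty subset I ⊆ {1,...,k} such that Σ_{s∈I} c_s = 0 in G and Σ_{s∈I} m_s/n_s ∈ p^h ℤ. -/
open Finset in
/-- If at least `J.card + 1` of the weights `y s` with `s ∈ T` equal `-1`, then the weighted sum over
subsets of `T` of a product of `J.card` affine functions of the indicator vector vanishes. -/
theorem sum_powerset_prod_affine_mul_prod_eq_zero {ι κ R : Type*} [CommRing R] [DecidableEq ι]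
    (β : κ → ι → R) (y : ι → R) (J : Finset κ) (α : κ → R) (T Z : Finset ι) (hZT : Z ⊆ T)
    (hy : ∀ s ∈ Z, y s = -1) (hJZ : J.card < Z.card) :
    ∑ I ∈ T.powerset, (∏ j ∈ J, (α j + ∑ s ∈ I, β j s)) * ∏ s ∈ I, y s = 0 := by
  classical
  induction J using Finset.induction_on generalizing α T Z with
  | empty =>
    obtain ⟨s, hs⟩ := Finset.card_pos.1 (by simpa using hJZ)
    simp only [prod_empty, one_mul]
    rw [← Finset.prod_one_add]
    exact Finset.prod_eq_zero (hZT hs) (by rw [hy s hs]; ring)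
  | insert j J hj ih =>
    rw [card_insert_of_notMem hj] at hJZ
    have key : ∀ I ∈ T.powerset,
        (∏ i ∈ insert j J, (α i + ∑ s ∈ I, β i s)) * ∏ s ∈ I, y s =
        α j * ((∏ i ∈ J, (α i + ∑ s ∈ I, β i s)) * ∏ s ∈ I, y s) +
        ∑ s ∈ T, if s ∈ I then
          β j s * ((∏ i ∈ J, (α i + ∑ s ∈ I, β i s)) * ∏ s ∈ I, y s) else 0 := by
      intro I hI
      rw [prod_insert hj, ← sum_filter, filter_mem_eq_inter,
        inter_eq_right.2 (mem_powerset.1 hI), ← sum_mul]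
      ring
    rw [sum_congr rfl key, sum_add_distrib, ← mul_sum, ih α T Z hZT hy (by omega), mul_zero,
      zero_add, sum_comm]
    refine sum_eq_zero fun s hs => ?_
    rw [← insert_erase hs, sum_powerset_insert (notMem_erase s T)]
    have h₁ : ∀ I ∈ (T.erase s).powerset, s ∉ I := fun I hI hsI =>
      notMem_erase s T (mem_powerset.1 hI hsI)
    rw [sum_eq_zero (fun I hI => if_neg (h₁ I hI)), zero_add]
    have h₂ : ∀ I ∈ (T.erase s).powerset,
        (if s ∈ insert s I then β j s * ((∏ i ∈ J, (α i + ∑ s ∈ insert s I, β i s)) *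
          ∏ s ∈ insert s I, y s) else 0) =
        β j s * y s * ((∏ i ∈ J, ((α i + β i s) + ∑ s ∈ I, β i s)) * ∏ s ∈ I, y s) := by
      intro I hI
      rw [if_pos (mem_insert_self s I), prod_insert (h₁ I hI)]
      simp only [sum_insert (h₁ I hI), add_assoc]
      ring
    rw [sum_congr rfl h₂, ← mul_sum, ih (fun i => α i + β i s) (T.erase s) (Z.erase s)
      (erase_subset_erase s hZT) (fun t ht => hy t (mem_of_mem_erase ht))
      (by have := pred_card_le_card_erase (s := Z) (a := s); omega), mul_zero]

theorem Int.prod_range_sub_eq_factorial_mul_choose (v : ℤ) (r : ℕ) :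
    ∏ i ∈ Finset.range r, (v - i) = r.factorial * Ring.choose v r := by
  have := Ring.descPochhammer_eq_factorial_smul_choose v r
  rw [nsmul_eq_mul] at this
  rw [← this, ← Polynomial.eval_eq_smeval, descPochhammer_eval_eq_prod_range]

theorem Int.mul_choose_sub_one (v : ℤ) (r : ℕ) :
    v * Ring.choose (v - 1) r = (r + 1 : ℕ) * Ring.choose v (r + 1) := by
  have h₁ := Int.prod_range_sub_eq_factorial_mul_choose (v - 1) r
  have h₂ := Int.prod_range_sub_eq_factorial_mul_choose v (r + 1)
  rw [Finset.prod_range_succ'] at h₂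
  have h₃ : ∏ i ∈ Finset.range r, (v - ((i + 1 : ℕ) : ℤ)) = ∏ i ∈ Finset.range r, (v - 1 - i) :=
    Finset.prod_congr rfl fun i _ => by push_cast; ring
  rw [h₃, h₁, Nat.factorial_succ] at h₂
  refine mul_left_cancel₀ (Nat.cast_ne_zero.2 r.factorial_ne_zero : (r.factorial : ℤ) ≠ 0) ?_
  push_cast at h₂ ⊢
  linear_combination h₂

theorem Int.prime_dvd_choose_sub_one {p : ℕ} (hp : p.Prime) (e : ℕ) {v : ℤ}
    (hv : ¬ (p : ℤ) ^ e ∣ v) : (p : ℤ) ∣ Ring.choose (v - 1) (p ^ e - 1) := by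
  have h := Int.mul_choose_sub_one v (p ^ e - 1)
  rw [Nat.sub_add_cancel (Nat.one_le_pow _ _ hp.pos)] at h
  by_contra hc
  have hcop : IsCoprime ((p : ℤ) ^ e) (Ring.choose (v - 1) (p ^ e - 1)) :=
    ((Nat.prime_iff_prime_int.1 hp).coprime_iff_not_dvd.2 hc).pow_left
  exact hv (hcop.dvd_of_dvd_mul_right ⟨_, by rw [h]; push_cast; rfl⟩)

theorem Int.isUnit_choose_neg_one (r : ℕ) : IsUnit (Ring.choose (-1 : ℤ) r) := by
  have h := Int.prod_range_sub_eq_factorial_mul_choose (-1) r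
  have h₁ : ∏ i ∈ Finset.range r, ((-1 : ℤ) - i) = r.factorial * (-1) ^ r := by
    rw [← Finset.prod_range_add_one_eq_factorial]
    push_cast
    rw [← Finset.card_range r, ← Finset.prod_const, Finset.card_range, ← Finset.prod_mul_distrib]
    exact Finset.prod_congr rfl fun i _ => by ring
  rw [h₁] at h
  rw [← mul_left_cancel₀ (Nat.cast_ne_zero.2 r.factorial_ne_zero : (r.factorial : ℤ) ≠ 0) h]
  exact isUnit_neg_one.pow r

theorem IsPrimitiveRoot.sum_range_zpow_mul {K : Type*} [Field K] {ζ : K} {N : ℕ}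
    (hζ : IsPrimitiveRoot ζ N) (B : ℤ) :
    ∑ x ∈ Finset.range N, ζ ^ (-(x : ℤ) * B) = if (N : ℤ) ∣ B then (N : K) else 0 := by
  have h₁ : ∀ x ∈ Finset.range N, ζ ^ (-(x : ℤ) * B) = (ζ ^ (-B)) ^ x := fun x _ => by
    rw [← zpow_natCast, ← zpow_mul]; congr 1; ring
  rw [Finset.sum_congr rfl h₁]
  split_ifs with hB
  · rw [(hζ.zpow_eq_one_iff_dvd (-B)).2 ((dvd_neg).2 hB)]
    simp
  · have hne : ζ ^ (-B) ≠ 1 := fun h => hB ((dvd_neg).1 ((hζ.zpow_eq_one_iff_dvd (-B)).1 h))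
    rw [geom_sum_eq hne, ← zpow_natCast, ← zpow_mul, mul_comm, zpow_mul, zpow_natCast,
      hζ.pow_eq_one, one_zpow, sub_self, zero_div]

theorem Complex.natCast_mul_ne_intCast_of_isIntegral {p : ℕ} {u : ℤ} (hu : ¬ (p : ℤ) ∣ u)
    {z : ℂ} (hz : IsIntegral ℤ z) : (p : ℂ) * z ≠ u := by
  intro h
  have hp : (p : ℂ) ≠ 0 := by
    intro hp
    rw [hp, zero_mul] at h
    exact hu (by rw [Int.cast_eq_zero.1 h.symm]; exact dvd_zero _)
  have hz' : z = algebraMap ℚ ℂ (u / p) := by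
    rw [eq_comm, map_div₀, map_intCast, map_natCast, ← h, mul_div_cancel_left₀ _ hp]
  rw [hz', isIntegral_algebraMap_iff (algebraMap ℚ ℂ).injective] at hz
  obtain ⟨w, hw⟩ := IsIntegrallyClosed.isIntegral_iff.1 hz
  refine hu ⟨w, ?_⟩
  have hp' : (p : ℚ) ≠ 0 := by exact_mod_cast hp
  rw [eq_div_iff hp'] at hw
  have : (w : ℚ) * p = u := hw
  rw [mul_comm]
  exact_mod_cast this.symm

open Finset in
/-- Orthogonality of characters extracts from a cover the vanishing of the signed sum of a product
of few affine functions over those index sets `I` with `N ∣ ∑ s ∈ I, b s`. -/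
theorem sum_filter_dvd_prod_affine_eq_zero {ι κ : Type*} [Fintype ι] [DecidableEq ι] [Fintype κ]
    {ζ : ℂ} {N : ℕ} (hN : 0 < N) (hζ : IsPrimitiveRoot ζ N) (a b : ι → ℤ) (α : κ → ℂ)
    (β : κ → ι → ℂ)
    (hcover : ∀ x : ℤ, Fintype.card κ < #{s | (N : ℤ) ∣ (a s - x) * b s}) :
    ∑ I : Finset ι with (N : ℤ) ∣ ∑ s ∈ I, b s,
      (∏ j, (α j + ∑ s ∈ I, β j s)) * ∏ s ∈ I, -ζ ^ (a s * b s) = 0 := by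
  have hζ0 : ζ ≠ 0 := hζ.ne_zero hN.ne'
  have h₁ (x : ℤ) : ∑ I : Finset ι, (∏ j, (α j + ∑ s ∈ I, β j s)) *
      ∏ s ∈ I, -ζ ^ ((a s - x) * b s) = 0 := by
    rw [← powerset_univ]
    refine sum_powerset_prod_affine_mul_prod_eq_zero β _ univ α univ _ (subset_univ _) ?_
      (hcover x)
    intro s hs
    rw [(hζ.zpow_eq_one_iff_dvd _).2 (mem_filter.1 hs).2]
  have h₂ (I : Finset ι) (x : ℤ) : ∏ s ∈ I, -ζ ^ ((a s - x) * b s) =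
      (∏ s ∈ I, -ζ ^ (a s * b s)) * ζ ^ (-x * ∑ s ∈ I, b s) := by
    induction I using Finset.induction_on with
    | empty => simp
    | insert s I hs ih =>
      rw [prod_insert hs, prod_insert hs, sum_insert hs, ih, mul_add, zpow_add₀ hζ0,
        show (a s - x) * b s = a s * b s + -x * b s by ring, zpow_add₀ hζ0]
      ring
  have h₃ : ∑ x ∈ range N, ∑ I : Finset ι, (∏ j, (α j + ∑ s ∈ I, β j s)) *
      ∏ s ∈ I, -ζ ^ ((a s - (x : ℤ)) * b s) = 0 := sum_eq_zero fun x _ => h₁ x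
  rw [sum_comm] at h₃
  simp only [h₂, ← mul_assoc, ← mul_sum, hζ.sum_range_zpow_mul, mul_ite, mul_zero] at h₃
  rw [← sum_filter, ← sum_mul] at h₃
  exact (mul_eq_zero.1 h₃).resolve_right (Nat.cast_ne_zero.2 hN.ne')

open Finset in
/-- Zero-sum principle for integer-valued data: if `u I o` is additive in `I` over the index sets with
`N ∣ ∑ s ∈ I, b s`, some nonempty such `I` has every `u I o` divisible by `p ^ e o`. -/
theorem exists_nonempty_dvd_of_cover {ι ο : Type*} [Fintype ι] [DecidableEq ι] [Fintype ο]
    {p : ℕ} (hp : p.Prime) (e : ο → ℕ) {N : ℕ} (hN : 0 < N) (a b : ι → ℤ)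
    (β : ο → ι → ℂ) (u : Finset ι → ο → ℤ)
    (hu : ∀ I : Finset ι, (N : ℤ) ∣ ∑ s ∈ I, b s → ∀ o, (u I o : ℂ) = ∑ s ∈ I, β o s)
    (hcover : ∀ x : ℤ, ∑ o, (p ^ e o - 1) < #{s | (N : ℤ) ∣ (a s - x) * b s}) :
    ∃ I : Finset ι, I.Nonempty ∧ (N : ℤ) ∣ ∑ s ∈ I, b s ∧ ∀ o, (p : ℤ) ^ e o ∣ u I o := by
  by_contra! hcon
  set ζ : ℂ := Complex.exp (2 * Real.pi * Complex.I / N)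
  have hζ : IsPrimitiveRoot ζ N := Complex.isPrimitiveRoot_exp N hN.ne'
  have hζint (z : ℤ) : IsIntegral ℤ (ζ ^ z) :=
    IsIntegral.of_pow hN (by
      rw [← zpow_natCast, ← zpow_mul, mul_comm, zpow_mul, zpow_natCast, hζ.pow_eq_one, one_zpow]
      exact isIntegral_one)
  let Q : Finset ι → ℤ := fun I => ∏ o, Ring.choose (u I o - 1) (p ^ e o - 1)
  let F : ℂ := ∏ o, ((p ^ e o - 1).factorial : ℂ)
  have hF : F ≠ 0 := prod_ne_zero_iff.2 fun o _ => Nat.cast_ne_zero.2 (Nat.factorial_ne_zero _)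
  have hsum := sum_filter_dvd_prod_affine_eq_zero
    (κ := Σ o, Fin (p ^ e o - 1)) hN hζ a b (fun j => -1 - (j.2 : ℂ)) (fun j => β j.1)
    (by simpa using hcover)
  have hQ : ∀ I ∈ ({I | (N : ℤ) ∣ ∑ s ∈ I, b s} : Finset (Finset ι)),
      (∏ j : Σ o, Fin (p ^ e o - 1), (-1 - (j.2 : ℂ) + ∑ s ∈ I, β j.1 s)) *
        ∏ s ∈ I, -ζ ^ (a s * b s) = F * (Q I * ∏ s ∈ I, -ζ ^ (a s * b s)) := by
    intro I hI
    rw [← mul_assoc]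
    congr 1
    rw [Fintype.prod_sigma, Int.cast_prod, ← prod_mul_distrib]
    refine prod_congr rfl fun o _ => ?_
    have h := congrArg (Int.cast : ℤ → ℂ)
      (Int.prod_range_sub_eq_factorial_mul_choose (u I o - 1) (p ^ e o - 1))
    push_cast at h
    rw [← h, ← Fin.prod_univ_eq_prod_range (fun i => (u I o : ℂ) - 1 - (i : ℂ)),
      hu I (mem_filter.1 hI).2 o]
    exact prod_congr rfl fun i _ => by ring
  rw [sum_congr rfl hQ, ← mul_sum] at hsum
  have hsum := (mul_eq_zero.1 hsum).resolve_left hF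
  have hempty : (∅ : Finset ι) ∈ ({I | (N : ℤ) ∣ ∑ s ∈ I, b s} : Finset (Finset ι)) := by simp
  rw [← add_sum_erase _ _ hempty] at hsum
  have hdvd : ∀ I ∈ ({I | (N : ℤ) ∣ ∑ s ∈ I, b s} : Finset (Finset ι)).erase ∅,
      (p : ℤ) ∣ Q I := by
    intro I hI
    obtain ⟨hne, hI⟩ := mem_erase.1 hI
    obtain ⟨o, ho⟩ := hcon I (nonempty_iff_ne_empty.2 hne) (mem_filter.1 hI).2
    exact (Int.prime_dvd_choose_sub_one hp (e o) ho).trans (dvd_prod_of_mem _ (mem_univ o))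
  have hQ0 : IsUnit (Q ∅) := by
    refine (IsUnit.prod_univ_iff).2 fun o => ?_
    have h0 : u ∅ o = 0 := by exact_mod_cast (hu ∅ (by simp) o).trans sum_empty
    rw [h0, zero_sub]
    exact Int.isUnit_choose_neg_one _
  have hp0 : ¬ (p : ℤ) ∣ -Q ∅ := fun h =>
    (Nat.prime_iff_prime_int.1 hp).not_isUnit (isUnit_of_dvd_unit ((dvd_neg).1 h) hQ0)
  refine Complex.natCast_mul_ne_intCast_of_isIntegral hp0
    (z := ∑ I ∈ ({I | (N : ℤ) ∣ ∑ s ∈ I, b s} : Finset (Finset ι)).erase ∅,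
      ((Q I / p : ℤ) : ℂ) * ∏ s ∈ I, -ζ ^ (a s * b s)) ?_ ?_
  · refine IsIntegral.sum _ fun I _ => IsIntegral.mul ?_ ?_
    · exact isIntegral_algebraMap (R := ℤ) (x := Q I / p)
    · exact IsIntegral.prod _ fun s _ => (hζint _).neg
  · have h : ∀ I ∈ ({I | (N : ℤ) ∣ ∑ s ∈ I, b s} : Finset (Finset ι)).erase ∅,
        (p : ℂ) * (((Q I / p : ℤ) : ℂ) * ∏ s ∈ I, -ζ ^ (a s * b s)) =
        Q I * ∏ s ∈ I, -ζ ^ (a s * b s) := fun I hI => by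
      rw [← mul_assoc]
      congr 1
      exact_mod_cast Int.mul_ediv_cancel' (hdvd I hI)
    rw [mul_sum, sum_congr rfl h]
    rw [prod_empty, mul_one] at hsum
    push_cast
    linear_combination hsum

/-- **Main Theorem (Theorem 2.1), existence part.**
If `{a s (n s)}_{s=1}^k` is a `(d*(G)+p^h)`-cover of `ℤ`, where `G = ⨁_t ℤ/p^{hvec t}ℤ`
and `d*(G) = ∑_t (p^{hvec t} - 1)`, then any `c₁,…,c_k ∈ G` has a nonempty zero-sum
subsequence `{c_s}_{s∈I}` with `∑_{s∈I} m_s/n_s ∈ p^h ℤ`. -/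
theorem stmt1 (p : ℕ) (hp : p.Prime) (l : ℕ) (hvec : Fin l → ℕ) (h : ℕ)
    (k : ℕ) (a : Fin k → ℤ) (n : Fin k → ℕ) (hn : ∀ s, 0 < n s)
    (hcover : ∀ x : ℤ,
      (∑ t, (p ^ hvec t - 1)) + p ^ h ≤
        (Finset.univ.filter fun s : Fin k => (n s : ℤ) ∣ x - a s).card)
    (c : Fin k → (∀ t, ZMod (p ^ hvec t))) (m : Fin k → ℤ) :
    ∃ I : Finset (Fin k), I.Nonempty ∧ (∑ s ∈ I, c s) = 0 ∧
      ∃ z : ℤ, ∑ s ∈ I, (m s : ℚ) / (n s : ℚ) = (p : ℚ) ^ h * z := by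
  have hN : 0 < ∏ s, n s := Finset.prod_pos fun s _ => hn s
  set N : ℕ := ∏ s, n s
  have hnN (s : Fin k) : n s ∣ N := Finset.dvd_prod_of_mem n (Finset.mem_univ s)
  choose d hd using hnN
  have hp1 : 1 ≤ p ^ h := Nat.one_le_pow _ _ hp.pos
  have hfrac (I : Finset (Fin k)) :
      ∑ s ∈ I, (m s : ℚ) / n s = ((∑ s ∈ I, m s * d s : ℤ) : ℚ) / N := by
    push_cast
    rw [Finset.sum_div]
    refine Finset.sum_congr rfl fun s _ => ?_
    have h₁ : (n s : ℚ) ≠ 0 := Nat.cast_ne_zero.2 (hn s).ne'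
    have h₂ : (N : ℚ) ≠ 0 := Nat.cast_ne_zero.2 hN.ne'
    have h₃ : (N : ℚ) = n s * d s := by exact_mod_cast hd s
    rw [div_eq_div_iff h₁ h₂, h₃]
    ring
  obtain ⟨I, hne, hI, hdvd⟩ := exists_nonempty_dvd_of_cover hp
    (fun o : Option (Fin l) => o.elim h hvec) hN a (fun s => m s * d s)
    (fun o s => o.elim (((m s * d s : ℤ) : ℂ) / N) fun t => ((c s t).val : ℂ))
    (fun I o => o.elim ((∑ s ∈ I, m s * d s) / N) fun t => ∑ s ∈ I, ((c s t).val : ℤ))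
    (by
      rintro I hI (_ | t)
      · simp only [Option.elim_none]
        rw [Int.cast_div hI (Nat.cast_ne_zero.2 hN.ne'), ← Finset.sum_div]
        push_cast
        rfl
      · simp)
    (by
      intro x
      rw [Fintype.sum_option]
      refine lt_of_lt_of_le ?_ ((hcover x).trans (Finset.card_le_card fun s hs => ?_))
      · simp only [Option.elim_none, Option.elim_some]
        omega
      · rw [Finset.mem_filter] at hs ⊢
        refine ⟨hs.1, ?_⟩
        rw [hd s, mul_left_comm, mul_comm (m s)]
        push_cast
        have : (n s : ℤ) ∣ a s - x := by rw [← dvd_neg, neg_sub]; exact hs.2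
        obtain ⟨w, hw⟩ := this
        exact ⟨w * m s, by rw [hw]; ring⟩)
  refine ⟨I, hne, ?_, ?_⟩
  · funext t
    have h₁ := hdvd (some t)
    simp only [Option.elim_some] at h₁
    have h₂ := (ZMod.intCast_zmod_eq_zero_iff_dvd (∑ s ∈ I, ((c s t).val : ℤ)) (p ^ hvec t)).2
      (by exact_mod_cast h₁)
    have : NeZero (p ^ hvec t) := ⟨pow_ne_zero _ hp.ne_zero⟩
    rw [Finset.sum_apply]
    simpa using h₂
  · obtain ⟨z, hz⟩ := hdvd none
    simp only [Option.elim_none] at hz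
    refine ⟨z, ?_⟩
    rw [hfrac I, ← Int.cast_natCast (R := ℚ) N,
      ← Int.cast_div hI (by exact_mod_cast hN.ne'), hz]
    push_cast
    rfl
end

section
/- Let p be a prime and G an abelian p-group, and suppose A = {a_s(n_s)}_{s=1}^k is a (d*(G)+1)-cover of ℤ. Let m_1,...,m_k ∈ ℤ. Then any sequence c_1,...,c_k of elements of G has a nonempty subset I ⊆ {1,...,k} with Σ_{s∈I} c_s = 0 in G and Σ_{s∈I} m_s/n_s ∈ ℤ. -/
open Finset

/-- `F` pairs to zero with every product function `I ↦ ∏ s ∈ I, z s` such that `z` takes the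
value `-1` more than `d` times. Polynomial functions of degree at most `d` have this property. -/
def AnnihilatesProducts {ι : Type*} [Fintype ι] [DecidableEq ι] (d : ℕ) (F : Finset ι → ℂ) :
    Prop :=
  ∀ z : ι → ℂ, d < #{s | z s = -1} → ∑ I, F I * ∏ s ∈ I, z s = 0

namespace AnnihilatesProducts

variable {ι : Type*} [Fintype ι] [DecidableEq ι] {d : ℕ} {F : Finset ι → ℂ}

lemma one : AnnihilatesProducts 0 (fun _ : Finset ι => (1 : ℂ)) := by
  intro z hz
  obtain ⟨s, hs⟩ := card_pos.mp hz
  have hs : z s = -1 := by simpa using hs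
  have h := prod_one_add (f := z) (univ : Finset ι)
  rw [powerset_univ] at h
  simp only [one_mul]
  rw [← h]
  exact prod_eq_zero (mem_univ s) (by rw [hs]; ring)

lemma const_mul (hF : AnnihilatesProducts d F) (r : ℂ) :
    AnnihilatesProducts d (fun I => r * F I) := by
  intro z hz
  simp only [mul_assoc, ← mul_sum, hF z hz, mul_zero]

lemma mul_indicator (hF : AnnihilatesProducts d F) (s : ι) :
    AnnihilatesProducts (d + 1) (fun I => F I * if s ∈ I then 1 else 0) := by
  intro z hz
  have hcard : d < #{i | Function.update z s 0 i = -1} := by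
    have hsub : ({i | z i = -1} : Finset ι).erase s ⊆
        ({i | Function.update z s 0 i = -1} : Finset ι) := by
      intro i hi
      simp only [mem_erase, mem_filter, mem_univ, true_and] at hi
      simp [Function.update_of_ne hi.1, hi.2]
    have h₁ := card_le_card hsub
    have h₂ := pred_card_le_card_erase (s := ({i | z i = -1} : Finset ι)) (a := s)
    omega
  have hz' := hF z (by omega)
  have hu := hF _ hcard
  refine add_eq_right.mp (Eq.trans ?_ (hz'.trans hu.symm))
  rw [← sum_add_distrib]
  refine sum_congr rfl fun I _ => ?_
  by_cases hs : s ∈ I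
  · rw [prod_eq_zero hs (Function.update_self s (0 : ℂ) z)]
    simp [hs]
  · rw [prod_congr rfl fun i hi => Function.update_of_ne (ne_of_mem_of_not_mem hi hs) (0 : ℂ) z]
    simp [hs]

lemma mul_affine (hF : AnnihilatesProducts d F) (β : ℂ) (γ : ι → ℂ) :
    AnnihilatesProducts (d + 1) (fun I => F I * (β + ∑ s ∈ I, γ s)) := by
  intro z hz
  have key (I : Finset ι) : F I * (β + ∑ s ∈ I, γ s) * ∏ s ∈ I, z s =
      β * (F I * ∏ s ∈ I, z s) +
        ∑ s, γ s * ((F I * if s ∈ I then 1 else 0) * ∏ s ∈ I, z s) := by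
    have h : ∑ s ∈ I, γ s = ∑ s, γ s * if s ∈ I then 1 else 0 := by simp
    rw [h, mul_add, add_mul, mul_sum, sum_mul]
    congr 1
    · ring
    · exact sum_congr rfl fun s _ => by ring
  simp only [key]
  rw [sum_add_distrib, sum_comm, ← mul_sum, hF z (by omega), mul_zero, zero_add]
  refine sum_eq_zero fun s _ => ?_
  rw [← mul_sum, hF.mul_indicator s z hz, mul_zero]

lemma mul_ascFactorial (hF : AnnihilatesProducts d F) (g : ι → ℕ) (r : ℕ) :
    AnnihilatesProducts (d + r)
      (fun I => F I * ((∑ s ∈ I, g s + 1).ascFactorial r : ℕ)) := by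
  induction r with
  | zero => simpa using hF
  | succ r ih =>
    have h := ih.mul_affine (1 + r) (fun s => (g s : ℂ))
    rw [add_assoc] at h
    refine (congrArg (AnnihilatesProducts _) (funext fun I => ?_)).mp h
    rw [Nat.ascFactorial_succ]
    push_cast
    ring

lemma mul_choose (hF : AnnihilatesProducts d F) (g : ι → ℕ) (r : ℕ) :
    AnnihilatesProducts (d + r)
      (fun I => F I * ((∑ s ∈ I, g s + r).choose r : ℕ)) := by
  convert (hF.mul_ascFactorial g r).const_mul ((r.factorial : ℂ)⁻¹) using 2 with I
  rw [Nat.ascFactorial_eq_factorial_mul_choose]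
  have : (r.factorial : ℂ) ≠ 0 := by exact_mod_cast r.factorial_ne_zero
  push_cast
  field_simp

lemma prod_choose {τ : Type*} (T : Finset τ) (g : τ → ι → ℕ) (r : τ → ℕ) :
    AnnihilatesProducts (∑ t ∈ T, r t)
      (fun I => ((∏ t ∈ T, (∑ s ∈ I, g t s + r t).choose (r t) : ℕ) : ℂ)) := by
  classical
  induction T using Finset.induction_on with
  | empty => simpa using one
  | insert t T ht ih =>
    rw [sum_insert ht, add_comm]
    convert ih.mul_choose (g t) (r t) using 2 with I
    rw [prod_insert ht]
    push_cast
    ring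

end AnnihilatesProducts

lemma Nat.Prime.dvd_choose_add_pow_sub_one {p : ℕ} (hp : p.Prime) {h L : ℕ}
    (hL : ¬ p ^ h ∣ L) : p ∣ (L + (p ^ h - 1)).choose (p ^ h - 1) := by
  by_contra hdvd
  have hpos : 0 < p ^ h := pow_pos hp.pos h
  have hmul := Nat.add_one_mul_choose_eq (L + (p ^ h - 1)) (p ^ h - 1)
  have hQ : p ^ h - 1 + 1 = p ^ h := by omega
  rw [add_assoc, hQ] at hmul
  have hcop : Nat.Coprime (p ^ h) ((L + (p ^ h - 1)).choose (p ^ h - 1)) :=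
    Nat.Coprime.pow_left h ((hp.coprime_iff_not_dvd).mpr hdvd)
  have : p ^ h ∣ L + p ^ h := hcop.dvd_of_dvd_mul_right (hmul ▸ dvd_mul_left _ _)
  exact hL ((Nat.dvd_add_left dvd_rfl).mp this)

lemma Complex.sum_range_exp_eq_zero {N : ℕ} {θ : ℚ} (hN : ∃ w : ℤ, (N : ℚ) * θ = w)
    (hθ : ¬ ∃ w : ℤ, θ = w) :
    ∑ x ∈ range N, Complex.exp (2 * Real.pi * Complex.I * (-(x : ℂ) * θ)) = 0 := by
  have hpi : (2 * Real.pi * Complex.I : ℂ) ≠ 0 := Complex.two_pi_I_ne_zero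
  set ω := Complex.exp (2 * Real.pi * Complex.I * (-(θ : ℂ))) with hω
  have hterm (x : ℕ) : Complex.exp (2 * Real.pi * Complex.I * (-(x : ℂ) * θ)) = ω ^ x := by
    rw [hω, ← Complex.exp_nat_mul]
    congr 1
    ring
  have hne : ω ≠ 1 := by
    intro h
    obtain ⟨w, hw⟩ := Complex.exp_eq_one_iff.mp h
    rw [mul_comm (w : ℂ)] at hw
    have hw := mul_left_cancel₀ hpi hw
    refine hθ ⟨-w, ?_⟩
    have : (θ : ℂ) = ((-w : ℤ) : ℂ) := by push_cast; rw [← hw]; ring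
    exact_mod_cast this
  have hone : ω ^ N = 1 := by
    obtain ⟨w, hw⟩ := hN
    have hw : (N : ℂ) * θ = w := by exact_mod_cast hw
    rw [← hterm, Complex.exp_eq_one_iff]
    refine ⟨-w, ?_⟩
    rw [neg_mul, hw]
    push_cast
    ring
  simp only [hterm]
  rw [geom_sum_eq hne, hone, sub_self, zero_div]

lemma Complex.isIntegral_exp_rat (θ : ℚ) :
    IsIntegral ℤ (Complex.exp (2 * Real.pi * Complex.I * θ)) := by
  refine IsIntegral.of_pow θ.den_pos ?_
  have : Complex.exp (2 * Real.pi * Complex.I * θ) ^ θ.den = 1 := by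
    rw [← Complex.exp_nat_mul, Complex.exp_eq_one_iff]
    refine ⟨θ.num, ?_⟩
    have h : (θ.den : ℂ) * θ = θ.num := by exact_mod_cast Rat.den_mul_eq_num θ
    rw [← h]
    ring
  rw [this]
  exact isIntegral_one

lemma Nat.Prime.not_isIntegral_of_mul_eq_one {p : ℕ} (hp : p.Prime) {x : ℂ}
    (hx : (p : ℂ) * x = 1) : ¬ IsIntegral ℤ x := by
  intro hint
  have hp0 : (p : ℂ) ≠ 0 := by exact_mod_cast hp.ne_zero
  have hxq : x = algebraMap ℚ ℂ ((p : ℚ)⁻¹) := by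
    rw [map_inv₀, map_natCast]
    exact eq_inv_of_mul_eq_one_right hx
  rw [hxq, isIntegral_algebraMap_iff (algebraMap ℚ ℂ).injective] at hint
  obtain ⟨y, hy⟩ := IsIntegrallyClosed.isIntegral_iff.mp hint
  have hpq : (p : ℚ) ≠ 0 := by exact_mod_cast hp.ne_zero
  have hpy : (p : ℚ) * y = 1 := by
    rw [show (y : ℚ) = (p : ℚ)⁻¹ by simpa using hy, mul_inv_cancel₀ hpq]
  have hpy : (p : ℤ) * y = 1 := by exact_mod_cast hpy
  exact (Nat.prime_iff_prime_int.mp hp).not_isUnit (IsUnit.of_mul_eq_one _ hpy)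

/-- Averaging over `x` isolates the subsets `I` with `∑ s ∈ I, m s / n s ∈ ℤ`. -/
lemma AnnihilatesProducts.sum_filter_eq_zero {ι : Type*} [Fintype ι] [DecidableEq ι] {d : ℕ}
    {F : Finset ι → ℂ} (hF : AnnihilatesProducts d F) (a m : ι → ℤ) (n : ι → ℕ)
    (hn : ∀ s, 0 < n s) (hcover : ∀ x : ℤ, d < #{s | (n s : ℤ) ∣ x - a s})
    [DecidablePred fun I : Finset ι => ∃ w : ℤ, ∑ s ∈ I, (m s : ℚ) / (n s : ℚ) = w] :
    ∑ I with ∃ w : ℤ, ∑ s ∈ I, (m s : ℚ) / (n s : ℚ) = w,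
      F I * ((-1) ^ #I * Complex.exp (2 * Real.pi * Complex.I *
        ((∑ s ∈ I, (a s : ℚ) * ((m s : ℚ) / n s) : ℚ) : ℂ))) = 0 := by
  set N := ∏ s, n s with hN
  have hN0 : (N : ℂ) ≠ 0 := by
    exact_mod_cast prod_ne_zero_iff.mpr fun s _ => (hn s).ne'
  let θ (I : Finset ι) : ℚ := ∑ s ∈ I, (m s : ℚ) / (n s : ℚ)
  let ψ (I : Finset ι) : ℚ := ∑ s ∈ I, (a s : ℚ) * ((m s : ℚ) / n s)
  let z (x : ℕ) (s : ι) : ℂ :=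
    -Complex.exp (2 * Real.pi * Complex.I * (((a s : ℂ) - x) * ((m s : ℂ) / n s)))
  have hz (x : ℕ) : ∑ I, F I * ∏ s ∈ I, z x s = 0 := by
    refine hF _ ((hcover x).trans_le (card_le_card fun s hs => ?_))
    simp only [mem_filter, mem_univ, true_and] at hs ⊢
    obtain ⟨q, hq⟩ := hs
    have hns : (n s : ℂ) ≠ 0 := by exact_mod_cast (hn s).ne'
    have hq : (x : ℂ) - a s = n s * q := by exact_mod_cast hq
    refine congrArg Neg.neg (Complex.exp_eq_one_iff.mpr ⟨-(q * m s), ?_⟩)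
    rw [← neg_sub, hq]
    push_cast
    field_simp
  have hprod (x : ℕ) (I : Finset ι) : ∏ s ∈ I, z x s =
      (-1) ^ #I * Complex.exp (2 * Real.pi * Complex.I * ψ I) *
        Complex.exp (2 * Real.pi * Complex.I * (-(x : ℂ) * θ I)) := by
    rw [prod_neg, ← Complex.exp_sum, mul_assoc ((-1) ^ #I), ← Complex.exp_add]
    congr 2
    simp only [θ, ψ]
    push_cast
    simp only [mul_sum, ← sum_add_distrib]
    exact sum_congr rfl fun s _ => by ring
  have hNθ (I : Finset ι) : ∃ w : ℤ, (N : ℚ) * θ I = w := by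
    have (s : ι) : ∃ w : ℤ, (N : ℚ) * ((m s : ℚ) / n s) = w := by
      obtain ⟨q, hq⟩ : n s ∣ N := dvd_prod_of_mem n (mem_univ s)
      have hns : (n s : ℚ) ≠ 0 := by exact_mod_cast (hn s).ne'
      refine ⟨q * m s, ?_⟩
      rw [hq]
      push_cast
      field_simp
    choose w hw using this
    refine ⟨∑ s ∈ I, w s, ?_⟩
    simp only [θ, mul_sum, hw]
    push_cast
    rfl
  have htotal : ∑ x ∈ range N, ∑ I, F I * ∏ s ∈ I, z x s = 0 := sum_eq_zero fun x _ => hz x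
  rw [sum_comm] at htotal
  refine (mul_eq_zero.mp ?_).resolve_left hN0
  rw [← htotal, sum_filter, mul_sum]
  refine sum_congr rfl fun I _ => ?_
  simp only [hprod, ← mul_sum, ← mul_assoc]
  split_ifs with hI
  · obtain ⟨w, hw⟩ := hI
    have hw : θ I = w := hw
    have hexp (x : ℕ) : Complex.exp (2 * Real.pi * Complex.I * (-(x : ℂ)) * θ I) = 1 :=
      Complex.exp_eq_one_iff.mpr ⟨-(x * w), by rw [hw]; push_cast; ring⟩
    simp only [hexp, sum_const, card_range, nsmul_eq_mul, mul_one]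
    simp only [ψ]
    ring
  · have h := Complex.sum_range_exp_eq_zero (hNθ I) hI
    simp only [← mul_assoc] at h
    rw [h, mul_zero, mul_zero]


/-- **Corollary 2.1.**
If `{a s (n s)}_{s=1}^k` is a `(d*(G)+1)`-cover of `ℤ`, where `G = ⨁_t ℤ/p^{hvec t}ℤ`
and `d*(G) = ∑_t (p^{hvec t} - 1)`, then any sequence `c₁,…,c_k ∈ G` has a nonempty
zero-sum subsequence `{c_s}_{s∈I}` with `∑_{s∈I} m_s/n_s ∈ ℤ`. -/
theorem stmt3 (p : ℕ) (hp : p.Prime) (l : ℕ) (hvec : Fin l → ℕ)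
    (k : ℕ) (a : Fin k → ℤ) (n : Fin k → ℕ) (hn : ∀ s, 0 < n s)
    (hcover : ∀ x : ℤ,
      (∑ t, (p ^ hvec t - 1)) + 1 ≤
        (Finset.univ.filter fun s : Fin k => (n s : ℤ) ∣ x - a s).card)
    (c : Fin k → (∀ t, ZMod (p ^ hvec t))) (m : Fin k → ℤ) :
    ∃ I : Finset (Fin k), I.Nonempty ∧ (∑ s ∈ I, c s) = 0 ∧
      ∃ z : ℤ, ∑ s ∈ I, (m s : ℚ) / (n s : ℚ) = z := by

  classical
  by_contra hcon
  let r (t : Fin l) : ℕ := p ^ hvec t - 1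
  let L (t : Fin l) (I : Finset (Fin k)) : ℕ := ∑ s ∈ I, (c s t).val
  let f (I : Finset (Fin k)) : ℕ := ∏ t, (L t I + r t).choose (r t)
  have hf : AnnihilatesProducts (∑ t, r t) (fun I => (f I : ℂ)) :=
    AnnihilatesProducts.prod_choose univ (fun t s => (c s t).val) r
  have hsum := hf.sum_filter_eq_zero a m n hn fun x => Nat.lt_of_succ_le (hcover x)
  have hdvd (I : Finset (Fin k)) (hI : I.Nonempty)
      (hθ : ∃ w : ℤ, ∑ s ∈ I, (m s : ℚ) / (n s : ℚ) = w) : p ∣ f I := by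
    have hne : ∑ s ∈ I, c s ≠ 0 := fun h => hcon ⟨I, hI, h, hθ⟩
    obtain ⟨t, ht⟩ := Function.ne_iff.mp hne
    refine (hp.dvd_choose_add_pow_sub_one fun h => ht ?_).trans (dvd_prod_of_mem _ (mem_univ t))
    have : NeZero (p ^ hvec t) := ⟨pow_ne_zero _ hp.ne_zero⟩
    have h := (ZMod.natCast_eq_zero_iff _ _).mpr h
    simp only [L] at h
    push_cast at h
    simpa using h
  choose! q hq using hdvd
  rw [← add_sum_erase _ _ (a := ∅)
    (mem_filter.mpr ⟨mem_univ _, 0, by simp⟩)] at hsum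
  let e (I : Finset (Fin k)) : ℂ := (-1) ^ #I * Complex.exp (2 * Real.pi * Complex.I *
    ((∑ s ∈ I, (a s : ℚ) * ((m s : ℚ) / n s) : ℚ) : ℂ))
  have he (I : Finset (Fin k)) : IsIntegral ℤ (e I) :=
    (isIntegral_one.neg.pow _).mul (Complex.isIntegral_exp_rat _)
  refine hp.not_isIntegral_of_mul_eq_one (x := -∑ I ∈ ({I | ∃ w : ℤ,
    ∑ s ∈ I, (m s : ℚ) / (n s : ℚ) = w} : Finset (Finset (Fin k))).erase ∅, q I * e I) ?_ ?_
  · have hf0 : f ∅ = 1 := by simp [f, L]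
    rw [hf0] at hsum
    rw [mul_neg, neg_eq_iff_eq_neg, mul_sum]
    have hrest := eq_neg_of_add_eq_zero_right hsum
    simp only [card_empty, pow_zero, sum_empty, Rat.cast_zero, mul_zero, Complex.exp_zero,
      Nat.cast_one, mul_one] at hrest
    rw [← hrest]
    refine sum_congr rfl fun I hI => ?_
    simp only [mem_erase, mem_filter, mem_univ, true_and] at hI
    rw [hq I (nonempty_iff_ne_empty.mpr hI.1) hI.2]
    simp only [e]
    push_cast
    ring
  · refine (IsIntegral.sum _ fun I _ => IsIntegral.mul ?_ (he I)).neg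
    exact_mod_cast isIntegral_algebraMap (R := ℤ) (A := ℂ) (x := (q I : ℤ))
end

section
/- Let A = {a_s(n_s)}_{s=1}^k be an m-cover of ℤ where m = p^n is a power of a prime p (n ∈ ℕ), and let m_1,...,m_k ∈ ℤ. Then for every subset J ⊆ {1,...,k} there exists a subset I ⊆ {1,...,k} with I ≠ J such that Σ_{s∈I} m_s/n_s − Σ_{s∈J} m_s/n_s ∈ m ℤ. -/
open Polynomial in
/-- In a domain containing a primitive `N`-th root of unity, `(X ^ N - 1) ^ m` divides every
polynomial vanishing to order `m` at all `N`-th roots of unity. -/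
theorem X_pow_sub_one_pow_dvd {R : Type*} [CommRing R] [IsDomain R] {ζ : R} {N : ℕ} (hN : 0 < N)
    (hζ : IsPrimitiveRoot ζ N) (m : ℕ) (P : R[X])
    (h : ∀ x : ℕ, (X - C (ζ ^ x)) ^ m ∣ P) : (X ^ N - 1) ^ m ∣ P := by
  classical
  rcases eq_or_ne P 0 with rfl | hP
  · exact dvd_zero _
  have key : (m • (nthRootsFinset N (1 : R)).val) ≤ P.roots := by
    refine Multiset.le_iff_count.2 fun r => ?_
    rw [Multiset.count_nsmul, count_roots]
    by_cases hr : r ∈ nthRootsFinset N (1 : R)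
    · rw [Multiset.count_eq_one_of_mem (nthRootsFinset N (1 : R)).nodup hr, mul_one,
        le_rootMultiplicity_iff hP]
      have hr' := (mem_nthRootsFinset hN (1 : R)).1 hr
      have : NeZero N := ⟨hN.ne'⟩
      obtain ⟨x, -, rfl⟩ := hζ.eq_pow_of_pow_eq_one hr'
      exact h x
    · rw [Multiset.count_eq_zero_of_notMem hr]
      simp
  have := (Multiset.prod_X_sub_C_dvd_iff_le_roots hP _).2 key
  rw [Multiset.map_nsmul, Multiset.prod_nsmul] at this
  rw [X_pow_sub_one_eq_prod hN hζ]
  exact this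

open Polynomial in
/-- A product vanishes at `z` to order at least the number of factors vanishing at `z`. -/
theorem X_sub_C_pow_dvd_prod {R ι : Type*} [CommRing R] [Fintype ι] (f : ι → R[X]) (z : R)
    (T : Finset ι) (hT : ∀ s ∈ T, (f s).IsRoot z) {m : ℕ} (hm : m ≤ T.card) :
    (X - C z) ^ m ∣ ∏ s, f s := by
  refine (pow_dvd_pow _ hm).trans ?_
  rw [← Finset.prod_const]
  exact (Finset.prod_dvd_prod_of_dvd _ _ fun s hs => dvd_iff_isRoot.2 (hT s hs)).trans
    (Finset.prod_dvd_prod_of_subset _ _ _ (Finset.subset_univ T))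

open Polynomial in
/-- If `(X ^ N - 1) ^ (p ^ e)` divides `∏ (1 + c_s X ^ b_s)` over a ring in which the prime `p` is
not invertible, then some nonempty subsum of the exponents is divisible by `N * p ^ e`. -/
theorem exists_nonempty_dvd_sum_of_X_pow_sub_one_pow_dvd {R ι : Type*} [CommRing R] [Fintype ι]
    {p : ℕ} (hp : p.Prime) (hpR : (p : R) ∈ nonunits R) (e N : ℕ) (c : ι → R) (b : ι → ℕ)
    (h : (X ^ N - 1) ^ (p ^ e) ∣ ∏ s, (1 + C (c s) * X ^ b s)) :
    ∃ I : Finset ι, I.Nonempty ∧ N * p ^ e ∣ ∑ s ∈ I, b s := by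
  classical
  by_contra! hI
  have : Fact p.Prime := ⟨hp⟩
  let F := R ⧸ Ideal.span {(p : R)}
  have : CharP F p := CharP.quotient R p hpR
  have : Nontrivial F := CharP.nontrivial_of_char_ne_one hp.ne_one
  let q : R →+* F := Ideal.Quotient.mk _
  let u : AddMonoidAlgebra F (ZMod (N * p ^ e)) := AddMonoidAlgebra.single 1 1
  let φ : R[X] →+* AddMonoidAlgebra F (ZMod (N * p ^ e)) :=
    (aeval (R := F) u).toRingHom.comp (mapRingHom q)
  have hu (j : ℕ) : u ^ j = AddMonoidAlgebra.single (j : ZMod (N * p ^ e)) (1 : F) := by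
    simp [u, AddMonoidAlgebra.single_pow]
  have hmon (s : ι) : φ (1 + C (c s) * X ^ b s) =
      1 + AddMonoidAlgebra.single (b s : ZMod (N * p ^ e)) (q (c s)) := by
    simp [φ, hu, AddMonoidAlgebra.single_mul_single]
  have hzero : φ ((X ^ N - 1) ^ (p ^ e)) = 0 := by
    have : mapRingHom q ((X ^ N - 1) ^ (p ^ e)) = X ^ (N * p ^ e) - 1 := by
      rw [map_pow, map_sub, map_pow, map_one, coe_mapRingHom, map_X, sub_pow_char_pow, one_pow,
        pow_mul]
    simp only [φ, RingHom.comp_apply, this]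
    simp [hu, AddMonoidAlgebra.one_def]
  have hprod : φ (∏ s, (1 + C (c s) * X ^ b s)) = 0 :=
    zero_dvd_iff.1 (hzero ▸ map_dvd φ h)
  have hmul (I : Finset ι) :
      ∏ s ∈ I, (AddMonoidAlgebra.single (b s : ZMod (N * p ^ e)) (q (c s)) :
          AddMonoidAlgebra F (ZMod (N * p ^ e))) =
        AddMonoidAlgebra.single ((∑ s ∈ I, b s : ℕ) : ZMod (N * p ^ e)) (∏ s ∈ I, q (c s)) := by
    induction I using Finset.induction_on with
    | empty => simp [AddMonoidAlgebra.one_def]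
    | insert s I hs ih =>
      rw [Finset.prod_insert hs, ih, Finset.prod_insert hs, Finset.sum_insert hs,
        AddMonoidAlgebra.single_mul_single, Nat.cast_add]
  rw [map_prod, Finset.prod_congr rfl fun s _ => hmon s, Finset.prod_one_add,
    Finset.sum_congr rfl fun I _ => hmul I] at hprod
  have hcoeff := congrArg (fun x : AddMonoidAlgebra F (ZMod (N * p ^ e)) => x.coeff 0) hprod
  simp only [AddMonoidAlgebra.coeff_sum, Finsupp.finsetSum_apply] at hcoeff
  rw [Finset.sum_eq_single ∅] at hcoeff
  · simp at hcoeff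
  · intro I _ hne
    have := hI I (Finset.nonempty_iff_ne_empty.2 hne)
    rw [AddMonoidAlgebra.coeff_single, Finsupp.single_apply, if_neg]
    rwa [ZMod.natCast_eq_zero_iff]
  · simp

open Polynomial in
/-- A `p ^ e`-cover with natural weights has a nonempty subset whose weighted reciprocal sum,
scaled by a common multiple `N` of the moduli, is divisible by `N * p ^ e`. -/
theorem exists_nonempty_dvd_sum_of_cover {p : ℕ} (hp : p.Prime) (e : ℕ) {ι : Type*} [Fintype ι]
    (a : ι → ℤ) (n : ι → ℕ) {N : ℕ} (hN : 0 < N) (hnN : ∀ s, n s ∣ N)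
    (hcover : ∀ x : ℤ, p ^ e ≤ (Finset.univ.filter fun s => (n s : ℤ) ∣ x - a s).card)
    (d : ι → ℕ) :
    ∃ I : Finset ι, I.Nonempty ∧ N * p ^ e ∣ ∑ s ∈ I, d s * (N / n s) := by
  let R := integralClosure ℤ ℂ
  have hζ₀ := Complex.isPrimitiveRoot_exp N hN.ne'
  let ζ : R := ⟨_, hζ₀.isIntegral hN⟩
  have hζ : IsPrimitiveRoot ζ N :=
    IsPrimitiveRoot.of_map_of_injective (f := R.val) hζ₀ Subtype.val_injective
  have hpR : (p : R) ∈ nonunits R := by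
    intro hu
    have h1 : IsUnit (algebraMap ℤ R (p : ℤ)) := by simpa using hu
    have h2 := isUnit_of_map_unit (algebraMap ℤ R) _ h1
    rw [Int.isUnit_iff_natAbs_eq, Int.natAbs_natCast] at h2
    exact hp.ne_one h2
  let a' (s : ι) : ℕ := (a s % N).toNat
  have ha' (s : ι) : (N : ℤ) ∣ a' s - a s := by
    have h0 : ((a' s : ℕ) : ℤ) = a s % N :=
      Int.toNat_of_nonneg (Int.emod_nonneg _ (Int.natCast_ne_zero.2 hN.ne'))
    rw [h0]
    exact ⟨-(a s / N), by linarith [Int.emod_add_mul_ediv (a s) N]⟩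
  refine exists_nonempty_dvd_sum_of_X_pow_sub_one_pow_dvd hp hpR e N
    (fun s => -ζ ^ (a' s * (d s * (N / n s)))) _
    (X_pow_sub_one_pow_dvd hN hζ _ _ fun x =>
      X_sub_C_pow_dvd_prod _ _ _ (fun s hs => ?_) (hcover (-x)))
  obtain ⟨t, ht⟩ : n s ∣ a' s + x := by
    have h1 : (n s : ℤ) ∣ -x - a s := (Finset.mem_filter.1 hs).2
    have h2 := (Int.natCast_dvd_natCast.2 (hnN s)).trans (ha' s)
    rw [← Int.natCast_dvd_natCast]
    have h3 := dvd_sub h2 h1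
    rwa [show (a' s - a s : ℤ) - (-x - a s) = (a' s + x : ℕ) by push_cast; ring] at h3
  have hpow : ζ ^ (a' s * (d s * (N / n s))) * (ζ ^ x) ^ (d s * (N / n s)) = 1 := by
    rw [← pow_mul, ← pow_add, hζ.pow_eq_one_iff_dvd, ← add_mul, ht]
    exact ⟨t * d s, by linear_combination (t * d s) * Nat.mul_div_cancel' (hnN s)⟩
  simp [IsRoot, ← hpow]

/-- A `p ^ e`-cover has a nonempty subset with weighted reciprocal sum in `p ^ e ℤ`. -/
theorem exists_nonempty_sum_div_eq_of_cover {p : ℕ} (hp : p.Prime) (e : ℕ) {ι : Type*} [Fintype ι]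
    (a : ι → ℤ) (n : ι → ℕ) (hn : ∀ s, 0 < n s)
    (hcover : ∀ x : ℤ, p ^ e ≤ (Finset.univ.filter fun s => (n s : ℤ) ∣ x - a s).card)
    (m : ι → ℤ) :
    ∃ I : Finset ι, I.Nonempty ∧ ∃ z : ℤ, ∑ s ∈ I, (m s : ℚ) / (n s : ℚ) = (p : ℚ) ^ e * z := by
  have hN : 0 < ∏ s, n s := Finset.prod_pos fun s _ => hn s
  have hnN (s : ι) : n s ∣ ∏ s, n s := Finset.dvd_prod_of_mem n (Finset.mem_univ s)
  generalize ∏ s, n s = N at hN hnN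
  have hM (s : ι) : ((n s * p ^ e : ℕ) : ℤ) ≠ 0 :=
    Int.natCast_ne_zero.2 (mul_pos (hn s) (pow_pos hp.pos e)).ne'
  obtain ⟨I, hI, t, ht⟩ := exists_nonempty_dvd_sum_of_cover hp e a n hN hnN hcover
    fun s => (m s % (n s * p ^ e : ℕ)).toNat
  refine ⟨I, hI, t + ∑ s ∈ I, m s / (n s * p ^ e : ℕ), ?_⟩
  have hterm (s : ι) : (m s : ℚ) / n s =
      (((m s % (n s * p ^ e : ℕ)).toNat * (N / n s) : ℕ) : ℚ) / N +
        (p : ℚ) ^ e * (m s / (n s * p ^ e : ℕ) : ℤ) := by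
    have h1 : (((m s % (n s * p ^ e : ℕ)).toNat : ℕ) : ℤ) = m s % (n s * p ^ e : ℕ) :=
      Int.toNat_of_nonneg (Int.emod_nonneg _ (hM s))
    have h2 := Int.emod_add_mul_ediv (m s) (n s * p ^ e : ℕ)
    rw [← h1] at h2
    have h3 : ((n s * (N / n s) : ℕ) : ℚ) = N := by rw [Nat.mul_div_cancel' (hnN s)]
    have h4 : (n s : ℚ) ≠ 0 := Nat.cast_ne_zero.2 (hn s).ne'
    have h5 : (N : ℚ) ≠ 0 := Nat.cast_ne_zero.2 hN.ne'
    have h6 := congrArg (Int.cast : ℤ → ℚ) h2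
    generalize (m s % (n s * p ^ e : ℕ)).toNat = r at *
    generalize m s / (n s * p ^ e : ℕ) = v at *
    generalize N / n s = w at *
    push_cast at h3 h6 ⊢
    rw [← h6, ← h3]
    have h7 : (w : ℚ) ≠ 0 := by rintro h; simp [h] at h3; exact h5 h3.symm
    field_simp
  rw [Finset.sum_congr rfl fun s _ => hterm s, Finset.sum_add_distrib, ← Finset.sum_div,
    ← Nat.cast_sum, ht, ← Finset.mul_sum]
  have h5 : (N : ℚ) ≠ 0 := Nat.cast_ne_zero.2 hN.ne'
  push_cast
  field_simp

/-- Passing from `J` to `I ∆ J` changes a sum by the sum over `I` with signs flipped on `J`. -/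
theorem sum_symmDiff_sub_sum {ι M : Type*} [DecidableEq ι] [AddCommGroup M] (I J : Finset ι)
    (f : ι → M) :
    ∑ s ∈ symmDiff I J, f s - ∑ s ∈ J, f s = ∑ s ∈ I, if s ∈ J then -f s else f s := by
  rw [symmDiff_def, Finset.sup_eq_union, Finset.sum_union disjoint_sdiff_sdiff,
    Finset.sum_ite, Finset.sum_neg_distrib, Finset.filter_mem_eq_inter,
    Finset.filter_notMem_eq_sdiff, ← Finset.sum_inter_add_sum_sdiff J I, Finset.inter_comm J I]
  abel

/-- **Corollary 2.2, second part.**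
If `{a s (n s)}_{s=1}^k` is an `m`-cover of `ℤ` with `m = p^e` a prime power, then for
any `J ⊆ {1,…,k}` there is an `I ⊆ {1,…,k}` with `I ≠ J` such that
`∑_{s∈I} m_s/n_s − ∑_{s∈J} m_s/n_s ∈ m ℤ`. -/
theorem stmt5 (p : ℕ) (hp : p.Prime) (e : ℕ)
    (k : ℕ) (a : Fin k → ℤ) (n : Fin k → ℕ) (hn : ∀ s, 0 < n s)
    (hcover : ∀ x : ℤ,
      p ^ e ≤ (Finset.univ.filter fun s : Fin k => (n s : ℤ) ∣ x - a s).card)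
    (m : Fin k → ℤ) :
    ∀ J : Finset (Fin k), ∃ I : Finset (Fin k), I ≠ J ∧
      ∃ z : ℤ, ∑ s ∈ I, (m s : ℚ) / (n s : ℚ) - ∑ s ∈ J, (m s : ℚ) / (n s : ℚ)
        = (p : ℚ) ^ e * z := by
  intro J
  obtain ⟨I, hI, z, hz⟩ := exists_nonempty_sum_div_eq_of_cover hp e a n hn hcover
    fun s => if s ∈ J then -m s else m s
  refine ⟨symmDiff I J, fun h => hI.ne_empty (symmDiff_eq_right.1 h), z, ?_⟩
  rw [sum_symmDiff_sub_sum, ← hz]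
  refine Finset.sum_congr rfl fun s _ => ?_
  split_ifs <;> push_cast <;> ring
end

section
/- Let p be a prime, G an abelian p-group, and let q be a power of p with q > d*(G). Let A = {a_s(n_s)}_{s=1}^k be a finite system of residue classes whose covering function satisfies d*(G) + q ≤ w_A(x) ≤ 2q for every integer x. Then any sequence c_1,...,c_k of elements of G has a subset I ⊆ {1,...,k} with Σ_{s∈I} c_s = 0 in G and Σ_{s∈I} 1/n_s = q. -/
open Finset

/-- The signed subset sum of a product of `#T` affine functionals, weighted by `y`, vanishes as
soon as more than `#T` of the weights are equal to `1`. -/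
theorem sum_powerset_prod_neg_mul_prod_affine_eq_zero {R ι τ : Type*} [CommRing R] [DecidableEq R]
    (y : ι → R) (T : Finset τ) (u : τ → ι → R) :
    ∀ (S : Finset ι) (b : τ → R), #T < #{s ∈ S | y s = 1} →
      ∑ I ∈ S.powerset, (∏ s ∈ I, -y s) * ∏ i ∈ T, (b i + ∑ s ∈ I, u i s) = 0 := by
  classical
  induction T using Finset.induction_on with
  | empty =>
    intro S b h
    obtain ⟨s, hs⟩ := card_pos.1 (lt_of_le_of_lt (Nat.zero_le _) h)
    rw [mem_filter] at hs
    simp only [prod_empty, mul_one]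
    rw [← prod_one_add]
    exact prod_eq_zero hs.1 (by simp [hs.2])
  | insert j T hj ih =>
    intro S b h
    rw [card_insert_of_notMem hj] at h
    have hsplit : ∀ I ∈ S.powerset,
        (∏ s ∈ I, -y s) * ∏ i ∈ insert j T, (b i + ∑ s ∈ I, u i s) =
          b j * ((∏ s ∈ I, -y s) * ∏ i ∈ T, (b i + ∑ s ∈ I, u i s)) +
          ∑ s ∈ S, if s ∈ I then
            u j s * ((∏ s ∈ I, -y s) * ∏ i ∈ T, (b i + ∑ s ∈ I, u i s)) else 0 := by
      intro I hI
      rw [prod_insert hj, ← sum_filter, filter_mem_eq_inter,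
        inter_eq_right.2 (mem_powerset.1 hI), ← sum_mul]
      ring
    rw [sum_congr rfl hsplit, sum_add_distrib, ← mul_sum, ih S b (by omega), mul_zero, zero_add,
      sum_comm]
    refine sum_eq_zero fun s hs => ?_
    have hcard : #T < #{r ∈ S.erase s | y r = 1} := by
      rw [filter_erase]
      have := pred_card_le_card_erase (s := {r ∈ S | y r = 1}) (a := s)
      omega
    have h0 := ih (S.erase s) (fun i => b i + u i s) hcard
    rw [← insert_erase hs, sum_powerset_insert (notMem_erase s S)]
    have hnot : ∀ I ∈ (S.erase s).powerset, s ∉ I := fun I hI hsI =>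
      notMem_erase s S (mem_powerset.1 hI hsI)
    rw [sum_eq_zero (fun I hI => by rw [if_neg (hnot I hI)]), zero_add]
    calc _ = ∑ I ∈ (S.erase s).powerset, (u j s * -y s) *
            ((∏ s ∈ I, -y s) * ∏ i ∈ T, (b i + u i s + ∑ s ∈ I, u i s)) := by
          refine sum_congr rfl fun I hI => ?_
          rw [if_pos (mem_insert_self s I), prod_insert (hnot I hI)]
          simp only [sum_insert (hnot I hI), add_assoc]
          ring
      _ = 0 := by rw [← mul_sum, h0, mul_zero]

/-- For `m = p ^ h - 1`, the integer-valued binomial polynomial `z ↦ (z - 1).choose m` is divisible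
by `p` off the multiples of `p ^ h` and is not divisible by `p` at `0`. -/
theorem exists_binomial_indicator_dvd {p : ℕ} (hp : p.Prime) (h : ℕ) :
    ∃ B : ℤ → ℤ,
      (∀ z, ((p ^ h - 1).factorial : ℤ) * B z =
        ∏ j ∈ range (p ^ h - 1), (z - (p ^ h - 1 : ℕ) + j)) ∧
      (∀ z, ¬ (p : ℤ) ^ h ∣ z → (p : ℤ) ∣ B z) ∧ ¬ (p : ℤ) ∣ B 0 := by
  obtain ⟨m, hm⟩ : ∃ m, p ^ h = m + 1 := ⟨p ^ h - 1, by have := pow_pos hp.pos h; omega⟩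
  have hm' : (p : ℤ) ^ h = m + 1 := by exact_mod_cast hm
  have hpp : Prime (p : ℤ) := Nat.prime_iff_prime_int.1 hp
  simp only [hm, Nat.add_sub_cancel]
  have hfac : (m.factorial : ℤ) ≠ 0 := by exact_mod_cast m.factorial_ne_zero
  choose B hB using fun z : ℤ => Nat.factorial_coe_dvd_prod m (z - m)
  refine ⟨B, fun z => (hB z).symm, fun z hz => ?_, ?_⟩
  · have h1 := Nat.factorial_coe_dvd_prod (m + 1) (z - m)
    rw [prod_range_succ, hB, Nat.factorial_succ] at h1
    have h2 : (m.factorial : ℤ) * (p : ℤ) ^ h ∣ m.factorial * (z * B z) := by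
      rw [hm']
      convert h1 using 1
      · push_cast; ring
      · ring
    have h3 := (mul_dvd_mul_iff_left hfac).1 h2
    by_contra hB'
    exact hz (IsCoprime.dvd_of_dvd_mul_right
      (((Prime.coprime_iff_not_dvd hpp).2 hB').pow_left) h3)
  · have key : ∀ m : ℕ, ∏ j ∈ range m, ((0 : ℤ) - m + j) = (-1) ^ m * m.factorial := by
      intro m
      induction m with
      | zero => simp
      | succ m ih =>
        rw [prod_range_succ', Nat.factorial_succ, pow_succ]
        have : ∏ j ∈ range m, ((0 : ℤ) - (m + 1 : ℕ) + (j + 1 : ℕ)) =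
            ∏ j ∈ range m, ((0 : ℤ) - m + j) :=
          prod_congr rfl fun j _ => by push_cast; ring
        rw [this, ih]
        push_cast
        ring
    have h1 := hB 0
    rw [key, mul_comm] at h1
    have h2 := mul_left_cancel₀ hfac h1
    rw [← h2]
    intro hd
    exact hpp.not_isUnit (isUnit_of_dvd_unit hd ((isUnit_neg_one).pow m))

/-- An integer that is `d` times an algebraic integer is divisible by `d`. -/
theorem Int.dvd_of_eq_mul_isIntegral {d β : ℤ} (hd : d ≠ 0) {γ : ℂ} (hγ : IsIntegral ℤ γ)
    (h : (β : ℂ) = d * γ) : d ∣ β := by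
  have hdC : (d : ℂ) ≠ 0 := by exact_mod_cast hd
  have h1 : algebraMap ℚ ℂ ((β : ℚ) / d) = γ := by
    simp only [map_div₀, map_intCast]
    rw [h, mul_div_cancel_left₀ _ hdC]
  rw [← h1, isIntegral_algebraMap_iff (algebraMap ℚ ℂ).injective] at hγ
  obtain ⟨y, hy⟩ := IsIntegrallyClosed.isIntegral_iff.1 hγ
  refine ⟨y, ?_⟩
  have hdQ : (d : ℚ) ≠ 0 := by exact_mod_cast hd
  rw [eq_div_iff hdQ] at hy
  have : ((β : ℤ) : ℚ) = ((d * y : ℤ) : ℚ) := by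
    rw [← hy]; push_cast; simp [mul_comm]
  exact_mod_cast this

/-- Orthogonality of the powers of a root of unity. -/
theorem IsPrimitiveRoot.sum_range_zpow {N : ℕ} {ζ : ℂ} (hζ : IsPrimitiveRoot ζ N)
    (M : ℤ) : ∑ x ∈ range N, (ζ ^ M) ^ x = if (N : ℤ) ∣ M then (N : ℂ) else 0 := by
  split_ifs with h
  · rw [(hζ.zpow_eq_one_iff_dvd M).2 h]; simp
  · have h1 : ζ ^ M ≠ 1 := fun h1 => h ((hζ.zpow_eq_one_iff_dvd M).1 h1)
    rw [geom_sum_eq h1, ← zpow_natCast, ← zpow_mul, mul_comm, zpow_mul, zpow_natCast,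
      hζ.pow_eq_one]
    simp

/-- The average of the covering function over a period is the sum of the densities. -/
theorem sum_range_card_filter_dvd_sub {ι : Type*} (S : Finset ι) (a : ι → ℤ) (n : ι → ℕ)
    (hn : ∀ s ∈ S, 0 < n s) {N : ℕ} (hN : ∀ s ∈ S, n s ∣ N) :
    ∑ x ∈ range N, (#{s ∈ S | (n s : ℤ) ∣ (x : ℤ) - a s} : ℚ) = N * ∑ s ∈ S, (1 : ℚ) / n s := by
  simp only [card_filter, Nat.cast_sum]
  rw [sum_comm, mul_sum]
  refine sum_congr rfl fun s hs => ?_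
  have hpos := hn s hs
  obtain ⟨m, rfl⟩ := hN s hs
  have hposQ : (n s : ℚ) ≠ 0 := by positivity
  rw [← Nat.cast_sum, ← card_filter]
  have h1 : #{x ∈ range (n s * m) | (n s : ℤ) ∣ ((x : ℕ) : ℤ) - a s} = m := by
    have h2 : ∀ x : ℕ, (n s : ℤ) ∣ (x : ℤ) - a s ↔ x ≡ (a s % n s).toNat [MOD n s] := by
      intro x
      rw [← Int.natCast_modEq_iff,
        Int.toNat_of_nonneg (Int.emod_nonneg _ (by exact_mod_cast hpos.ne')),
        ← Int.modEq_iff_dvd]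
      simp [Int.ModEq, eq_comm]
    simp only [h2]
    rw [← Nat.count_eq_card_filter_range, Nat.count_modEq_card _ hpos]
    simp [hpos]
  rw [h1]
  push_cast
  field_simp

/-- If the classes indexed by `S` cover every integer more than `∑ i, (p ^ h i - 1)` times, then
some nonempty `I ⊆ S` with integral density has all the linear forms `Z i` divisible by `p ^ h i`.
The forms are integral on index sets of integral density. -/
theorem exists_nonempty_forall_pow_dvd {ι τ : Type*} [Fintype τ] {p : ℕ} (hp : p.Prime)
    (h : τ → ℕ) (S : Finset ι) (a : ι → ℤ) (n m : ι → ℕ) {N : ℕ} (hN : 0 < N)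
    (hnm : ∀ s ∈ S, n s * m s = N)
    (hcover : ∀ x : ℤ, ∑ i, (p ^ h i - 1) < #{s ∈ S | (n s : ℤ) ∣ x - a s})
    (u : τ → ι → ℂ) (Z : τ → Finset ι → ℤ)
    (hZ : ∀ i, ∀ I ⊆ S, N ∣ ∑ s ∈ I, m s → ∑ s ∈ I, u i s = Z i I) :
    ∃ I ⊆ S, I.Nonempty ∧ N ∣ ∑ s ∈ I, m s ∧ ∀ i, (p : ℤ) ^ h i ∣ Z i I := by
  classical
  by_contra! hcon
  choose B hBfac hBdvd hB0 using fun i => exists_binomial_indicator_dvd hp (h i)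
  obtain ⟨ζ, hζ⟩ : ∃ ζ : ℂ, IsPrimitiveRoot ζ N :=
    ⟨_, Complex.isPrimitiveRoot_exp N hN.ne'⟩
  have hζ0 : ζ ≠ 0 := hζ.ne_zero hN.ne'
  have hNC : (N : ℂ) ≠ 0 := by exact_mod_cast hN.ne'
  set W : ι → ℂ := fun s => ζ ^ (-(m s * a s : ℤ)) with hW
  have hWint : ∀ s, IsIntegral ℤ (W s) := by
    intro s
    refine IsIntegral.of_pow hN (x := W s) ?_
    rw [hW]
    simp only
    rw [← zpow_natCast, ← zpow_mul, mul_comm, zpow_mul, zpow_natCast, hζ.pow_eq_one, one_zpow]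
    exact isIntegral_one
  set F : ℂ := ∏ i, ((p ^ h i - 1).factorial : ℂ) with hF
  have hF0 : F ≠ 0 := prod_ne_zero_iff.2 fun i _ => by exact_mod_cast Nat.factorial_ne_zero _
  set P : Finset ι → ℂ := fun I => ∏ q : (Σ i : τ, Fin (p ^ h i - 1)),
    ((-((p ^ h q.1 - 1 : ℕ) : ℂ) + (q.2 : ℕ)) + ∑ s ∈ I, u q.1 s) with hP
  have hvanish : ∀ x : ℕ,
      ∑ I ∈ S.powerset, (∏ s ∈ I, -(ζ ^ (m s * ((x : ℤ) - a s)))) * P I = 0 := by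
    intro x
    refine sum_powerset_prod_neg_mul_prod_affine_eq_zero
      (fun s => ζ ^ (m s * ((x : ℤ) - a s))) univ
      (fun (q : (Σ i : τ, Fin (p ^ h i - 1))) s => u q.1 s) S
      (fun q => -((p ^ h q.1 - 1 : ℕ) : ℂ) + (q.2 : ℕ)) ?_
    rw [card_univ, Fintype.card_sigma]
    simp only [Fintype.card_fin]
    refine (hcover x).trans_eq (congrArg card (filter_congr fun s hs => ?_))
    have hm0 : (m s : ℤ) ≠ 0 := by
      have := hnm s hs
      rintro h0
      simp only [Nat.cast_eq_zero] at h0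
      rw [h0] at this
      omega
    rw [hζ.zpow_eq_one_iff_dvd, ← hnm s hs]
    push_cast
    rw [mul_comm, mul_dvd_mul_iff_left hm0]
  have hPval : ∀ I ⊆ S, N ∣ ∑ s ∈ I, m s → P I = F * ((∏ i, B i (Z i I) : ℤ) : ℂ) := by
    intro I hI hd
    rw [hP, hF]
    simp only
    rw [Fintype.prod_sigma]
    push_cast
    rw [← prod_mul_distrib]
    refine prod_congr rfl fun i _ => ?_
    have := congrArg (Int.cast : ℤ → ℂ) (hBfac i (Z i I))
    rw [hZ i I hI hd]
    push_cast at this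
    rw [this, ← Fin.prod_univ_eq_prod_range
      (fun j => (Z i I : ℂ) - ((p ^ h i - 1 : ℕ) : ℂ) + (j : ℂ))]
    exact prod_congr rfl fun j _ => by ring
  have hsum : ∑ I ∈ S.powerset, (if N ∣ ∑ s ∈ I, m s then
      (∏ s ∈ I, -W s) * ((∏ i, B i (Z i I) : ℤ) : ℂ) else 0) = 0 := by
    have h0 : ∑ x ∈ range N, ∑ I ∈ S.powerset,
        (∏ s ∈ I, -(ζ ^ (m s * ((x : ℤ) - a s)))) * P I = 0 :=
      sum_eq_zero fun x _ => hvanish x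
    rw [sum_comm] at h0
    have h1 : ∀ I ∈ S.powerset, ∑ x ∈ range N,
        (∏ s ∈ I, -(ζ ^ (m s * ((x : ℤ) - a s)))) * P I =
        (N * F) * (if N ∣ ∑ s ∈ I, m s then
          (∏ s ∈ I, -W s) * ((∏ i, B i (Z i I) : ℤ) : ℂ) else 0) := by
      intro I hI
      have h2 : ∀ x : ℕ, (∏ s ∈ I, -(ζ ^ (m s * ((x : ℤ) - a s)))) * P I =
          (ζ ^ ((∑ s ∈ I, m s : ℕ) : ℤ)) ^ x * ((∏ s ∈ I, -W s) * P I) := by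
        intro x
        rw [← mul_assoc]
        congr 1
        rw [zpow_natCast, ← prod_pow_eq_pow_sum, ← prod_pow, ← prod_mul_distrib]
        refine prod_congr rfl fun s _ => ?_
        rw [hW]
        simp only
        rw [← pow_mul, ← zpow_natCast, mul_neg, ← zpow_add₀ hζ0]
        congr 2
        push_cast
        ring
      simp only [h2]
      rw [← sum_mul, hζ.sum_range_zpow]
      simp only [Int.natCast_dvd_natCast]
      split_ifs with hd
      · rw [hPval I (mem_powerset.1 hI) hd]; ring
      · simp
    rw [sum_congr rfl h1, ← mul_sum] at h0
    exact (mul_eq_zero.1 h0).resolve_left (mul_ne_zero hNC hF0)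
  have hpC : ∀ I ∈ S.powerset.erase ∅, ∃ γ : ℂ, IsIntegral ℤ γ ∧
      (if N ∣ ∑ s ∈ I, m s then
        (∏ s ∈ I, -W s) * ((∏ i, B i (Z i I) : ℤ) : ℂ) else 0) = p * γ := by
    intro I hI
    rw [mem_erase, mem_powerset] at hI
    split_ifs with hd
    · obtain ⟨i, hi⟩ := hcon I hI.2 (nonempty_iff_ne_empty.2 hI.1) hd
      obtain ⟨b, hb⟩ := (hBdvd i _ hi).trans (dvd_prod_of_mem (fun i => B i (Z i I)) (mem_univ i))
      refine ⟨(∏ s ∈ I, -W s) * b, (IsIntegral.prod _ fun s _ => (hWint s).neg).mul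
        (isIntegral_algebraMap (x := b)), ?_⟩
      rw [hb]
      push_cast
      ring
    · exact ⟨0, isIntegral_zero, by simp⟩
  choose! γ hγ hγeq using hpC
  rw [← add_sum_erase _ _ (empty_mem_powerset S), sum_congr rfl hγeq, ← mul_sum] at hsum
  simp only [sum_empty, dvd_zero, if_true, prod_empty, one_mul] at hsum
  have hZ0 : ∀ i, Z i ∅ = 0 := fun i => by
    have := hZ i ∅ (empty_subset S) (by simp)
    rw [sum_empty] at this
    exact_mod_cast this.symm
  have hpp : Prime (p : ℤ) := Nat.prime_iff_prime_int.1 hp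
  have hdvd : (p : ℤ) ∣ ∏ i, B i (Z i ∅) := by
    refine Int.dvd_of_eq_mul_isIntegral hpp.ne_zero
      (IsIntegral.sum _ hγ).neg ?_
    rw [eq_neg_of_add_eq_zero_left hsum]
    push_cast
    ring
  obtain ⟨i, -, hi⟩ := (hpp.dvd_finsetProd_iff _).1 hdvd
  rw [hZ0] at hi
  exact hB0 i hi

/-- If the classes indexed by `S` cover every integer at least `d*(G) + p ^ e` times, then some
nonempty `I ⊆ S` has zero sum in `G` and density a multiple of `p ^ e`. -/
theorem exists_nonempty_zero_sum_density_multiple {ι : Type*} {p : ℕ} (hp : p.Prime) {l : ℕ}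
    (hvec : Fin l → ℕ) (e : ℕ) (S : Finset ι) (a : ι → ℤ) (n : ι → ℕ) (hn : ∀ s ∈ S, 0 < n s)
    (hcover : ∀ x : ℤ, (∑ t, (p ^ hvec t - 1)) + p ^ e ≤ #{s ∈ S | (n s : ℤ) ∣ x - a s})
    (c : ι → ∀ t, ZMod (p ^ hvec t)) :
    ∃ I ⊆ S, I.Nonempty ∧ ∑ s ∈ I, c s = 0 ∧
      ∃ z : ℤ, ∑ s ∈ I, (1 : ℚ) / n s = ((p ^ e : ℕ) : ℚ) * z := by
  classical
  set N := ∏ s ∈ S, n s with hNdef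
  have hN : 0 < N := prod_pos hn
  have hnm : ∀ s ∈ S, n s * (N / n s) = N := fun s hs => Nat.mul_div_cancel' (dvd_prod_of_mem n hs)
  have hNQ : (N : ℚ) ≠ 0 := by exact_mod_cast hN.ne'
  have hdens : ∀ I ⊆ S, ∑ s ∈ I, (1 : ℚ) / n s = ((∑ s ∈ I, N / n s : ℕ) : ℚ) / N := by
    intro I hI
    rw [Nat.cast_sum, sum_div]
    refine sum_congr rfl fun s hs => ?_
    have h1 : (n s : ℚ) ≠ 0 := by exact_mod_cast (hn s (hI hs)).ne'
    rw [div_eq_div_iff h1 hNQ, one_mul, mul_comm]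
    exact_mod_cast (hnm s (hI hs)).symm
  choose c' hc' using fun s t => ZMod.intCast_surjective (c s t)
  obtain ⟨I, hIS, hI, hd, hZ⟩ := exists_nonempty_forall_pow_dvd hp
    (fun i : Option (Fin l) => i.elim e hvec) S a n (fun s => N / n s) hN hnm
    (fun x => by
      refine lt_of_lt_of_le ?_ (hcover x)
      rw [Fintype.sum_option]
      have := pow_pos hp.pos e
      simp only [Option.elim]
      omega)
    (fun i s => i.elim (((N / n s : ℕ) : ℂ) / N) fun t => (c' s t : ℂ))
    (fun i I => i.elim (((∑ s ∈ I, N / n s) / N : ℕ) : ℤ) fun t => ∑ s ∈ I, c' s t)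
    (by
      rintro (_ | t) I hI hd
      · simp only [Option.elim]
        rw [← sum_div, Int.cast_natCast, Nat.cast_div hd (by exact_mod_cast hN.ne'), Nat.cast_sum]
      · simp)
  refine ⟨I, hIS, hI, ?_, ?_⟩
  · funext t
    have := hZ (some t)
    simp only [Option.elim] at this
    rw [Finset.sum_apply, Pi.zero_apply, ← sum_congr rfl fun s _ => hc' s t, ← Int.cast_sum,
      ZMod.intCast_zmod_eq_zero_iff_dvd]
    exact_mod_cast this
  · obtain ⟨z, hz⟩ := hZ none
    simp only [Option.elim] at hz
    refine ⟨z, ?_⟩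
    rw [hdens I hIS, ← Nat.cast_div hd hNQ, ← Int.cast_natCast, hz]
    push_cast
    ring

/-- A finite system whose covering function is bounded by `b`, with strict inequality at `x₀`,
has density less than `b`. -/
theorem sum_one_div_lt_of_card_filter_dvd_sub_le {ι : Type*} (S : Finset ι) (a : ι → ℤ)
    (n : ι → ℕ) (hn : ∀ s ∈ S, 0 < n s) {b : ℕ} (hb : ∀ x : ℤ, #{s ∈ S | (n s : ℤ) ∣ x - a s} ≤ b)
    {x₀ : ℤ} (hx₀ : #{s ∈ S | (n s : ℤ) ∣ x₀ - a s} < b) : ∑ s ∈ S, (1 : ℚ) / n s < b := by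
  have hN : 0 < ∏ s ∈ S, n s := prod_pos hn
  have h := sum_range_card_filter_dvd_sub S (fun s => a s - x₀) n hn
    (N := ∏ s ∈ S, n s) fun s hs => dvd_prod_of_mem n hs
  simp only [← sub_add, sub_add_eq_add_sub] at h
  have hlt : ∑ x ∈ range (∏ s ∈ S, n s), (#{s ∈ S | (n s : ℤ) ∣ (x : ℤ) + x₀ - a s} : ℚ) <
      ∑ x ∈ range (∏ s ∈ S, n s), (b : ℚ) := by
    refine sum_lt_sum (fun x _ => by exact_mod_cast hb _) ⟨0, mem_range.2 hN, ?_⟩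
    simpa using hx₀
  rw [h, sum_const, card_range, nsmul_eq_mul] at hlt
  exact lt_of_mul_lt_mul_left hlt (Nat.cast_nonneg _)


/-- **Theorem 2.2(i).**
Let `G = ⨁_t ℤ/p^{hvec t}ℤ` be an abelian `p`-group with `d*(G) = ∑_t (p^{hvec t}-1)`,
and let `q` be a power of `p` with `q > d*(G)`.  If the covering function of
`A = {a s (n s)}_{s=1}^k` satisfies `d*(G) + q ≤ w_A(x) ≤ 2q` for all `x ∈ ℤ`, then any
`c₁,…,c_k ∈ G` has a zero-sum subsequence `{c_s}_{s∈I}` with `∑_{s∈I} 1/n_s = q`. -/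
theorem stmt6 (p : ℕ) (hp : p.Prime) (l : ℕ) (hvec : Fin l → ℕ) (e : ℕ) (q : ℕ)
    (hq : q = p ^ e) (hqd : (∑ t, (p ^ hvec t - 1)) < q)
    (k : ℕ) (a : Fin k → ℤ) (n : Fin k → ℕ) (hn : ∀ s, 0 < n s)
    (hcover : ∀ x : ℤ,
      (∑ t, (p ^ hvec t - 1)) + q ≤
          (Finset.univ.filter fun s : Fin k => (n s : ℤ) ∣ x - a s).card ∧
        (Finset.univ.filter fun s : Fin k => (n s : ℤ) ∣ x - a s).card ≤ 2 * q)
    (c : Fin k → (∀ t, ZMod (p ^ hvec t))) :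
    ∃ I : Finset (Fin k), (∑ s ∈ I, c s) = 0 ∧
      ∑ s ∈ I, (1 : ℚ) / (n s : ℚ) = q := by
  classical
  subst hq
  obtain ⟨S, hS, hlt⟩ : ∃ S : Finset (Fin k),
      (∀ x : ℤ, (∑ t, (p ^ hvec t - 1)) + p ^ e ≤ #{s ∈ S | (n s : ℤ) ∣ x - a s}) ∧
        ∑ s ∈ S, (1 : ℚ) / n s < (2 * p ^ e : ℕ) := by
    by_cases hall : ∀ x : ℤ, #{s : Fin k | (n s : ℤ) ∣ x - a s} = 2 * p ^ e
    · obtain ⟨s₀, hs₀⟩ := card_pos.1 (((Nat.zero_le _).trans_lt hqd).trans_le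
        ((Nat.le_add_left _ _).trans (hcover 0).1))
      have herase : ∀ x : ℤ, #{s ∈ univ.erase s₀ | (n s : ℤ) ∣ x - a s} =
          #(({s | (n s : ℤ) ∣ x - a s} : Finset (Fin k)).erase s₀) := fun x => by
        rw [filter_erase]
      refine ⟨univ.erase s₀, fun x => ?_, sum_one_div_lt_of_card_filter_dvd_sub_le _ a n
        (fun s _ => hn s) (fun x => ?_) (x₀ := 0) ?_⟩
      · have := pred_card_le_card_erase (s := {s : Fin k | (n s : ℤ) ∣ x - a s}) (a := s₀)
        rw [hall x] at this
        rw [herase]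
        omega
      · rw [herase]
        exact (card_erase_le).trans (hcover x).2
      · rw [herase]
        exact (card_erase_lt_of_mem hs₀).trans_eq (hall 0)
    · push Not at hall
      obtain ⟨x₀, hx₀⟩ := hall
      exact ⟨univ, fun x => (hcover x).1, sum_one_div_lt_of_card_filter_dvd_sub_le _ a n
        (fun s _ => hn s) (fun x => (hcover x).2) ((hcover x₀).2.lt_of_ne hx₀)⟩
  obtain ⟨I, hIS, hI, hc, z, hz⟩ :=
    exists_nonempty_zero_sum_density_multiple hp hvec e S a n (fun s _ => hn s) hS c
  refine ⟨I, hc, ?_⟩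
  have hterm : ∀ s, 0 < (1 : ℚ) / n s := fun s => by
    have := hn s
    positivity
  have hpos : 0 < ∑ s ∈ I, (1 : ℚ) / n s := sum_pos (fun s _ => hterm s) hI
  have hle : ∑ s ∈ I, (1 : ℚ) / n s ≤ ∑ s ∈ S, (1 : ℚ) / n s :=
    sum_le_sum_of_subset_of_nonneg hIS fun s _ _ => (hterm s).le
  have hqpos : (0 : ℚ) < (p ^ e : ℕ) := by exact_mod_cast pow_pos hp.pos e
  have hz0 : 0 < z := by
    have : (0 : ℚ) < z := pos_of_mul_pos_right (hz ▸ hpos) hqpos.le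
    exact_mod_cast this
  have hz2 : z < 2 := by
    have h2 : ((p ^ e : ℕ) : ℚ) * z < (p ^ e : ℕ) * 2 := by
      rw [← hz, mul_comm]
      exact_mod_cast hle.trans_lt hlt
    exact_mod_cast lt_of_mul_lt_mul_left h2 hqpos.le
  obtain rfl : z = 1 := by omega
  rw [hz, Int.cast_one, mul_one]
end

section
/- Let p be a prime, G an abelian p-group, and let q be a power of p with q > d*(G). Let A = {a_s(n_s)}_{s=1}^k be an exact 3q-cover of ℤ (i.e., w_A(x) = 3q for all x ∈ ℤ). Then any sequence c_1,...,c_k of elements of G ⊕ G with Σ_{s=1}^k c_s = 0 has a subset I ⊆ {1,...,k} with Σ_{s∈I} c_s = 0 in G ⊕ G and Σ_{s∈I} 1/n_s = q. -/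
/-- The functions on the subsets of `ι` that are polynomials of degree at most `d` in the
indicators of the elements. -/
def setPolynomials (ι : Type*) [DecidableEq ι] (d : ℕ) : Submodule ℂ (Finset ι → ℂ) :=
  Submodule.span ℂ {f | ∃ J : Finset ι, J.card ≤ d ∧ f = fun I => if J ⊆ I then 1 else 0}

section SetPolynomials

variable {ι : Type*} [DecidableEq ι]

lemma one_mem_setPolynomials (d : ℕ) : (1 : Finset ι → ℂ) ∈ setPolynomials ι d :=
  Submodule.subset_span ⟨∅, by simp, by ext; simp⟩

lemma mul_mem_setPolynomials {d d' : ℕ} {f g : Finset ι → ℂ}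
    (hf : f ∈ setPolynomials ι d) (hg : g ∈ setPolynomials ι d') :
    f * g ∈ setPolynomials ι (d + d') := by
  have h := Submodule.mul_mem_mul hf hg
  rw [setPolynomials, setPolynomials, Submodule.span_mul_span] at h
  refine Submodule.span_mono ?_ h
  rintro _ ⟨_, ⟨J, hJ, rfl⟩, _, ⟨J', hJ', rfl⟩, rfl⟩
  refine ⟨J ∪ J', (Finset.card_union_le _ _).trans (add_le_add hJ hJ'), ?_⟩
  ext I
  by_cases h1 : J ⊆ I <;> by_cases h2 : J' ⊆ I <;> simp [Finset.union_subset_iff, h1, h2]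

lemma prod_mem_setPolynomials {τ : Type*} (T : Finset τ) (d : τ → ℕ) (f : τ → Finset ι → ℂ)
    (hf : ∀ t ∈ T, f t ∈ setPolynomials ι (d t)) :
    ∏ t ∈ T, f t ∈ setPolynomials ι (∑ t ∈ T, d t) := by
  classical
  induction T using Finset.induction_on with
  | empty => simpa using one_mem_setPolynomials 0
  | insert t T ht ih =>
    rw [Finset.prod_insert ht, Finset.sum_insert ht]
    exact mul_mem_setPolynomials (hf t (Finset.mem_insert_self _ _))
      (ih fun u hu => hf u (Finset.mem_insert_of_mem hu))

lemma ite_mem_setPolynomials (s : ι) :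
    (fun I : Finset ι => if s ∈ I then (1 : ℂ) else 0) ∈ setPolynomials ι 1 :=
  Submodule.subset_span ⟨{s}, by simp, by ext; simp⟩

lemma sum_mem_setPolynomials [Fintype ι] (w : ι → ℂ) :
    (fun I : Finset ι => ∑ s ∈ I, w s) ∈ setPolynomials ι 1 := by
  have h : (fun I : Finset ι => ∑ s ∈ I, w s) =
      ∑ s, w s • fun I : Finset ι => if s ∈ I then (1 : ℂ) else 0 := by
    ext I
    simp [Finset.sum_apply]
  rw [h]
  exact Submodule.sum_mem _ fun s _ => Submodule.smul_mem _ _ (ite_mem_setPolynomials s)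

/-- The polynomial in `x` that takes the value `(x + r).choose r` at a natural number `x`. -/
noncomputable def shiftedChoose (r : ℕ) (x : ℂ) : ℂ :=
  (r.factorial : ℂ)⁻¹ * ∏ i ∈ Finset.range r, (x + (i + 1))

lemma shiftedChoose_natCast (r x : ℕ) : shiftedChoose r x = ((x + r).choose r : ℕ) := by
  have h : ((x + 1).ascFactorial r : ℂ) = ∏ i ∈ Finset.range r, ((x : ℂ) + (i + 1)) := by
    rw [Nat.ascFactorial_eq_prod_range]
    push_cast
    exact Finset.prod_congr rfl fun i _ => by ring
  rw [shiftedChoose, ← h, Nat.ascFactorial_eq_factorial_mul_choose, Nat.cast_mul,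
    inv_mul_cancel_left₀ (by exact_mod_cast r.factorial_ne_zero)]

lemma shiftedChoose_mem_setPolynomials [Fintype ι] (r : ℕ) (w : ι → ℂ) :
    (fun I : Finset ι => shiftedChoose r (∑ s ∈ I, w s)) ∈ setPolynomials ι r := by
  have h : (fun I : Finset ι => shiftedChoose r (∑ s ∈ I, w s)) =
      (r.factorial : ℂ)⁻¹ • ∏ i ∈ Finset.range r,
        ((fun I : Finset ι => ∑ s ∈ I, w s) + ((i : ℂ) + 1) • (1 : Finset ι → ℂ)) := by
    ext I
    simp [shiftedChoose, Finset.prod_apply]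
  rw [h]
  refine Submodule.smul_mem _ _ ?_
  have := prod_mem_setPolynomials (Finset.range r) (fun _ => 1)
    (fun i : ℕ => (fun I : Finset ι => ∑ s ∈ I, w s) + ((i : ℂ) + 1) • (1 : Finset ι → ℂ))
    fun i _ => add_mem (sum_mem_setPolynomials w)
      (Submodule.smul_mem _ _ (one_mem_setPolynomials 1))
  simpa using this

lemma sum_prod_neg_mul_eq_zero [Fintype ι] {d : ℕ} {z : ι → ℂ}
    (hz : d < (Finset.univ.filter fun s => z s = 1).card) {g : Finset ι → ℂ}
    (hg : g ∈ setPolynomials ι d) :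
    ∑ I : Finset ι, (∏ s ∈ I, -z s) * g I = 0 := by
  induction hg using Submodule.span_induction with
  | mem f hf =>
    obtain ⟨J, hJ, rfl⟩ := hf
    obtain ⟨s, hs, hsJ⟩ := Finset.exists_mem_notMem_of_card_lt_card (hJ.trans_lt hz)
    have h := Finset.prod_add (fun s => -z s) (fun s => if s ∈ J then (0 : ℂ) else 1) Finset.univ
    rw [Finset.prod_eq_zero (Finset.mem_univ s)
      (by simp [hsJ, (Finset.mem_filter.mp hs).2]), Finset.powerset_univ] at h
    refine Eq.trans ?_ h.symm
    refine Finset.sum_congr rfl fun I _ => ?_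
    congr 1
    dsimp only
    split_ifs with hI
    · refine (Finset.prod_eq_one fun i hi => if_neg fun hiJ => ?_).symm
      exact (Finset.mem_sdiff.mp hi).2 (hI hiJ)
    · obtain ⟨i, hi, hiI⟩ := Finset.not_subset.mp hI
      symm
      refine Finset.prod_eq_zero (Finset.mem_sdiff.mpr ⟨Finset.mem_univ i, hiI⟩) ?_
      exact if_pos hi
  | zero => simp
  | add f g _ _ hf hg => simp [mul_add, Finset.sum_add_distrib, hf, hg]
  | smul r f _ hf =>
    have : ∀ I : Finset ι, (∏ s ∈ I, -z s) * (r • f) I = r * ((∏ s ∈ I, -z s) * f I) :=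
      fun I => by simp only [Pi.smul_apply, smul_eq_mul]; ring
    simp_rw [this, ← Finset.mul_sum, hf, mul_zero]

end SetPolynomials

lemma dvd_choose_of_not_dvd {p : ℕ} (hp : p.Prime) {h x : ℕ} (hx : ¬ p ^ h ∣ x) :
    p ∣ (x + (p ^ h - 1)).choose (p ^ h - 1) := by
  have hpos : 0 < p ^ h := pow_pos hp.pos h
  have key := Nat.add_one_mul_choose_eq (x + (p ^ h - 1)) (p ^ h - 1)
  rw [Nat.sub_add_cancel hpos, add_assoc, Nat.sub_add_cancel hpos] at key
  by_contra hc
  have hcop : Nat.Coprime (p ^ h) ((x + (p ^ h - 1)).choose (p ^ h - 1)) :=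
    Nat.Coprime.pow_left h ((Nat.Prime.coprime_iff_not_dvd hp).mpr hc)
  have := hcop.dvd_of_dvd_mul_right (key ▸ dvd_mul_left (p ^ h) _)
  exact hx ((Nat.dvd_add_left (dvd_refl _)).mp this)

lemma not_isIntegral_of_prime_mul_eq_one {p : ℕ} (hp : p.Prime) {β : ℂ}
    (hβ : (p : ℂ) * β = 1) : ¬ IsIntegral ℤ β := by
  intro hint
  have hp0 : (p : ℂ) ≠ 0 := by exact_mod_cast hp.ne_zero
  have h1 : algebraMap ℚ ℂ ((p : ℚ)⁻¹) = β := by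
    rw [map_inv₀, map_natCast]
    exact inv_eq_of_mul_eq_one_right hβ
  rw [← h1] at hint
  have h2 : IsIntegral ℤ ((p : ℚ)⁻¹) :=
    (isIntegral_algebraMap_iff (algebraMap ℚ ℂ).injective).mp hint
  obtain ⟨y, hy⟩ := IsIntegrallyClosed.isIntegral_iff.mp h2
  have h3 : (p : ℤ) * y = 1 := by
    have hpq : (p : ℚ) ≠ 0 := by exact_mod_cast hp.ne_zero
    have : (p : ℚ) * (y : ℚ) = 1 := by
      rw [show (y : ℚ) = (p : ℚ)⁻¹ from hy, mul_inv_cancel₀ hpq]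
    exact_mod_cast this
  have h4 : (p : ℤ) ∣ 1 := Dvd.intro _ h3
  exact hp.one_lt.ne' (by exact_mod_cast Int.eq_one_of_dvd_one (by positivity) h4)

section Cover

open Complex

lemma exp_eq_one_iff_dvd {n : ℕ} (hn : 0 < n) (b : ℤ) :
    exp (2 * Real.pi * I * ((b : ℂ) / n)) = 1 ↔ (n : ℤ) ∣ b := by
  have hn0 : (n : ℂ) ≠ 0 := by exact_mod_cast hn.ne'
  rw [exp_eq_one_iff]
  constructor
  · rintro ⟨m, hm⟩
    refine ⟨m, ?_⟩
    rw [mul_comm (m : ℂ), mul_right_inj' two_pi_I_ne_zero, div_eq_iff hn0] at hm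
    rw [mul_comm]
    exact_mod_cast hm
  · rintro ⟨m, rfl⟩
    refine ⟨m, ?_⟩
    push_cast
    field_simp

lemma sum_range_pow_eq_zero {w : ℂ} {N : ℕ} (hw : w ^ N = 1) (h1 : w ≠ 1) :
    ∑ x ∈ Finset.range N, w ^ x = 0 := by
  rw [geom_sum_eq h1, hw, sub_self, zero_div]

lemma isIntegral_exp_two_pi_I_div (a : ℤ) {n : ℕ} (hn : 0 < n) :
    IsIntegral ℤ (exp (2 * Real.pi * I * ((a : ℂ) / n))) := by
  refine IsIntegral.of_pow hn ?_
  have hn0 : (n : ℂ) ≠ 0 := by exact_mod_cast hn.ne'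
  have : exp (2 * Real.pi * I * ((a : ℂ) / n)) ^ n = 1 := by
    rw [← exp_nat_mul, exp_eq_one_iff]
    exact ⟨a, by field_simp⟩
  rw [this]
  exact isIntegral_one

variable {ι : Type*}

lemma exists_natCast_eq_sum_reciprocal {n : ι → ℕ} {J : Finset ι}
    (h : exp (-(2 * Real.pi * I * ∑ s ∈ J, (1 : ℂ) / n s)) = 1) :
    ∃ M : ℕ, ∑ s ∈ J, (1 : ℚ) / n s = M := by
  rw [exp_neg, inv_eq_one, exp_eq_one_iff] at h
  obtain ⟨m, hm⟩ := h
  rw [mul_comm (m : ℂ), mul_right_inj' two_pi_I_ne_zero] at hm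
  have hq : ∑ s ∈ J, (1 : ℚ) / n s = m := by
    apply_fun ((↑) : ℚ → ℂ) using Rat.cast_injective
    push_cast
    exact hm
  have h0 : (0 : ℚ) ≤ m := hq ▸ Finset.sum_nonneg fun s _ => by positivity
  lift m to ℕ using (by exact_mod_cast h0)
  exact ⟨m, by exact_mod_cast hq⟩

variable [Fintype ι]

/-- If a system of residue classes covers every integer more than `d` times, then polynomials of
degree at most `d` are annihilated by a signed sum over the sets whose reciprocal sum is an
integer. -/
lemma sum_integral_reciprocal_eq_zero [DecidableEq ι] {d : ℕ} (a : ι → ℤ) (n : ι → ℕ)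
    (hn : ∀ s, 0 < n s)
    (hcover : ∀ x : ℤ, d < (Finset.univ.filter fun s : ι => (n s : ℤ) ∣ x - a s).card)
    {g : Finset ι → ℂ} (hg : g ∈ setPolynomials ι d) :
    ∑ J : Finset ι with exp (-(2 * Real.pi * I * ∑ s ∈ J, (1 : ℂ) / n s)) = 1,
      (∏ s ∈ J, -exp (2 * Real.pi * I * (a s / n s))) * g J = 0 := by
  set N := ∏ s, n s with hN
  have hNpos : 0 < N := Finset.prod_pos fun s _ => hn s
  have hx (x : ℕ) : ∑ J : Finset ι, (∏ s ∈ J, -exp (2 * Real.pi * I * (a s / n s))) * g J *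
      exp (-(2 * Real.pi * I * ∑ s ∈ J, (1 : ℂ) / n s)) ^ x = 0 := by
    rw [← sum_prod_neg_mul_eq_zero
      (z := fun s => exp (2 * Real.pi * I * (((a s - x : ℤ) : ℂ) / n s))) (g := g) (d := d) _ hg]
    · refine Finset.sum_congr rfl fun J _ => ?_
      rw [mul_right_comm]
      congr 1
      have h2 : exp (-(2 * Real.pi * I * ∑ s ∈ J, (1 : ℂ) / n s)) ^ x =
          ∏ s ∈ J, exp (-(2 * Real.pi * I * (x / n s))) := by
        rw [← exp_nat_mul, ← exp_sum, Finset.sum_neg_distrib, Finset.mul_sum, mul_neg,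
          Finset.mul_sum]
        congr 2
        exact Finset.sum_congr rfl fun s _ => by ring
      rw [h2, ← Finset.prod_mul_distrib]
      refine Finset.prod_congr rfl fun s _ => ?_
      rw [neg_mul, ← exp_add]
      congr 2
      push_cast
      ring
    · refine (hcover x).trans_le (Finset.card_le_card fun s hs => ?_)
      simp only [Finset.mem_filter, Finset.mem_univ, true_and] at hs ⊢
      rw [exp_eq_one_iff_dvd (hn s), ← neg_sub, dvd_neg]
      exact hs
  have hsum : ∑ x ∈ Finset.range N,
      ∑ J : Finset ι, (∏ s ∈ J, -exp (2 * Real.pi * I * (a s / n s))) * g J *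
      exp (-(2 * Real.pi * I * ∑ s ∈ J, (1 : ℂ) / n s)) ^ x = 0 :=
    Finset.sum_eq_zero fun x _ => hx x
  rw [Finset.sum_comm] at hsum
  have hN0 : (N : ℂ) ≠ 0 := by exact_mod_cast hNpos.ne'
  refine (mul_eq_zero.mp (?_ : _ * (N : ℂ) = 0)).resolve_right hN0
  rw [← hsum, Finset.sum_filter, Finset.sum_mul]
  refine Finset.sum_congr rfl fun J _ => ?_
  rw [← Finset.mul_sum]
  split_ifs with h1
  · simp only [h1, one_pow, Finset.sum_const, Finset.card_range, nsmul_eq_mul, mul_one]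
  · rw [sum_range_pow_eq_zero _ h1, mul_zero, zero_mul]
    rw [← exp_nat_mul, mul_neg, exp_neg, inv_eq_one, exp_eq_one_iff]
    refine ⟨∑ s ∈ J, ((N / n s : ℕ) : ℤ), ?_⟩
    rw [mul_left_comm, Finset.mul_sum, mul_comm, Int.cast_sum]
    congr 1
    refine Finset.sum_congr rfl fun s _ => ?_
    rw [Int.cast_natCast, Nat.cast_div (Finset.dvd_prod_of_mem n (Finset.mem_univ s))
      (Nat.cast_ne_zero.mpr (hn s).ne'), mul_one_div]

/-- A Davenport-constant theorem for covers: in a system covering every integer often enough,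
some nonempty set avoiding a given index has all the prescribed weight sums, and its reciprocal
sum, divisible by the prescribed powers of `p`. -/
lemma exists_nonempty_zero_sum_of_cover [DecidableEq ι] {τ : Type*} [Fintype τ] {p : ℕ}
    (hp : p.Prime) (h : τ → ℕ) (e : ℕ) (a : ι → ℤ) (n : ι → ℕ) (hn : ∀ s, 0 < n s)
    (hcover : ∀ x : ℤ, ∑ t, (p ^ h t - 1) + (p ^ e - 1) + 1 <
      (Finset.univ.filter fun s : ι => (n s : ℤ) ∣ x - a s).card)
    (b : τ → ι → ℕ) (s₀ : ι) :
    ∃ J : Finset ι, J.Nonempty ∧ s₀ ∉ J ∧ (∀ t, p ^ h t ∣ ∑ s ∈ J, b t s) ∧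
      ∃ M : ℕ, ∑ s ∈ J, (1 : ℚ) / n s = M ∧ p ^ e ∣ M := by
  by_contra! hcon
  set g : Finset ι → ℂ := (∏ t, fun J => shiftedChoose (p ^ h t - 1) (∑ s ∈ J, (b t s : ℂ))) *
    (fun J => shiftedChoose (p ^ e - 1) (∑ s ∈ J, (1 : ℂ) / n s)) *
    (1 - fun J => if s₀ ∈ J then (1 : ℂ) else 0) with hg
  have hgmem : g ∈ setPolynomials ι (∑ t, (p ^ h t - 1) + (p ^ e - 1) + 1) :=
    mul_mem_setPolynomials (mul_mem_setPolynomials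
      (prod_mem_setPolynomials _ _ _ fun t _ => shiftedChoose_mem_setPolynomials _ _)
      (shiftedChoose_mem_setPolynomials _ _))
      (sub_mem (one_mem_setPolynomials 1) (ite_mem_setPolynomials s₀))
  have hgval (J : Finset ι) (M : ℕ) (hM : ∑ s ∈ J, (1 : ℚ) / n s = M) :
      g J = (((∏ t, (∑ s ∈ J, b t s + (p ^ h t - 1)).choose (p ^ h t - 1)) *
        (M + (p ^ e - 1)).choose (p ^ e - 1) * (if s₀ ∈ J then 0 else 1) : ℕ) : ℂ) := by
    have hM' : ∑ s ∈ J, (1 : ℂ) / n s = (M : ℂ) := by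
      have := congrArg ((↑) : ℚ → ℂ) hM
      push_cast at this
      exact this
    simp only [hg, Pi.mul_apply, Finset.prod_apply, Pi.sub_apply, Pi.one_apply, hM',
      ← Nat.cast_sum, shiftedChoose_natCast]
    split_ifs <;> simp
  have hsum := sum_integral_reciprocal_eq_zero a n hn hcover hgmem
  rw [← Finset.add_sum_erase _ _ (a := ∅) (by simp)] at hsum
  have hg0 : g ∅ = 1 := by simp [hgval ∅ 0 (by simp)]
  rw [Finset.prod_empty, one_mul, hg0] at hsum
  have hterm : ∀ J ∈ (Finset.univ.filter fun J : Finset ι =>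
      exp (-(2 * Real.pi * I * ∑ s ∈ J, (1 : ℂ) / n s)) = 1).erase ∅,
      ∃ β : ℂ, IsIntegral ℤ β ∧
        (∏ s ∈ J, -exp (2 * Real.pi * I * (a s / n s))) * g J = p * β := by
    intro J hJ
    obtain ⟨hJ0, hJ⟩ := Finset.mem_erase.mp hJ
    obtain ⟨M, hM⟩ := exists_natCast_eq_sum_reciprocal (Finset.mem_filter.mp hJ).2
    have hdvd : p ∣ (∏ t, (∑ s ∈ J, b t s + (p ^ h t - 1)).choose (p ^ h t - 1)) *
        (M + (p ^ e - 1)).choose (p ^ e - 1) * (if s₀ ∈ J then 0 else 1) := by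
      by_cases hs : s₀ ∈ J
      · simp [hs]
      refine Dvd.dvd.mul_right ?_ _
      by_cases ht : ∀ t, p ^ h t ∣ ∑ s ∈ J, b t s
      · exact Dvd.dvd.mul_left (dvd_choose_of_not_dvd hp
          (hcon J (Finset.nonempty_iff_ne_empty.mpr hJ0) hs ht M hM)) _
      · push Not at ht
        obtain ⟨t, ht⟩ := ht
        exact ((dvd_choose_of_not_dvd hp ht).trans (Finset.dvd_prod_of_mem
          (fun t => (∑ s ∈ J, b t s + (p ^ h t - 1)).choose (p ^ h t - 1))
          (Finset.mem_univ t))).mul_right _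
    obtain ⟨y, hy⟩ := hdvd
    refine ⟨(∏ s ∈ J, -exp (2 * Real.pi * I * (a s / n s))) * y, ?_, ?_⟩
    · exact (IsIntegral.prod _ fun s _ => (isIntegral_exp_two_pi_I_div (a s) (hn s)).neg).mul
        (by simpa using isIntegral_algebraMap (R := ℤ) (A := ℂ) (x := (y : ℤ)))
    · rw [hgval J M hM, hy]
      push_cast
      ring
  choose! β hβ hβ' using hterm
  rw [Finset.sum_congr rfl hβ', ← Finset.mul_sum] at hsum
  refine not_isIntegral_of_prime_mul_eq_one hp (β := -∑ J ∈ _, β J) ?_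
    (IsIntegral.sum _ hβ).neg
  linear_combination -hsum

lemma sum_reciprocal_of_exact_cover (a : ι → ℤ) (n : ι → ℕ) (hn : ∀ s, 0 < n s) {m : ℕ}
    (hcover : ∀ x : ℤ, (Finset.univ.filter fun s : ι => (n s : ℤ) ∣ x - a s).card = m) :
    ∑ s, (1 : ℚ) / n s = m := by
  set N := ∏ s, n s with hN
  have hNpos : 0 < N := Finset.prod_pos fun s _ => hn s
  have hdvd (s : ι) : n s ∣ N := Finset.dvd_prod_of_mem n (Finset.mem_univ s)
  have hcount (s : ι) :
      ((Finset.Ico (0 : ℤ) N).filter fun x => (n s : ℤ) ∣ x - a s).card = N / n s := by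
    obtain ⟨r, hr⟩ := hdvd s
    have hs : (0 : ℤ) < n s := by exact_mod_cast hn s
    have h := Int.Ico_filter_modEq_card 0 (N : ℤ) hs (a s)
    have hfilter : ((Finset.Ico (0 : ℤ) N).filter fun x => (n s : ℤ) ∣ x - a s) =
        (Finset.Ico (0 : ℤ) N).filter (· ≡ a s [ZMOD n s]) :=
      Finset.filter_congr fun x _ => by rw [Int.modEq_comm, Int.modEq_iff_dvd]
    have hs' : (n s : ℚ) ≠ 0 := by exact_mod_cast (hn s).ne'
    have hceil : ((N : ℤ) - a s : ℚ) / (n s : ℤ) = ((0 : ℤ) - a s : ℚ) / (n s : ℤ) + (r : ℤ) := by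
      rw [hr]
      push_cast
      field_simp
      ring
    rw [hfilter]
    rw [hceil, Int.ceil_add_intCast, add_sub_cancel_left, max_eq_left (by positivity)] at h
    rw [Nat.div_eq_of_eq_mul_right (hn s) hr]
    exact_mod_cast h
  have hdouble : ∑ s, N / n s = N * m := by
    simp_rw [← hcount, Finset.card_filter]
    rw [Finset.sum_comm]
    simp_rw [← Finset.card_filter, hcover]
    simp
  have hN0 : (N : ℚ) ≠ 0 := by exact_mod_cast hNpos.ne'
  apply mul_left_cancel₀ hN0
  rw [Finset.mul_sum, ← Nat.cast_mul, ← hdouble, Nat.cast_sum]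
  refine Finset.sum_congr rfl fun s _ => ?_
  rw [Nat.cast_div (hdvd s) (by exact_mod_cast (hn s).ne'), mul_one_div]

end Cover

/-- **Theorem 2.2(ii).**
Let `G = ⨁_t ℤ/p^{hvec t}ℤ` be an abelian `p`-group with `d*(G) = ∑_t (p^{hvec t}-1)`,
and let `q` be a power of `p` with `q > d*(G)`.  If `A = {a s (n s)}_{s=1}^k` is an exact
`3q`-cover of `ℤ`, then any zero-sum sequence `c₁,…,c_k ∈ G ⊕ G` has a zero-sum
subsequence `{c_s}_{s∈I}` with `∑_{s∈I} 1/n_s = q`. -/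
theorem stmt7 (p : ℕ) (hp : p.Prime) (l : ℕ) (hvec : Fin l → ℕ) (e : ℕ) (q : ℕ)
    (hq : q = p ^ e) (hqd : (∑ t, (p ^ hvec t - 1)) < q)
    (k : ℕ) (a : Fin k → ℤ) (n : Fin k → ℕ) (hn : ∀ s, 0 < n s)
    (hcover : ∀ x : ℤ,
      (Finset.univ.filter fun s : Fin k => (n s : ℤ) ∣ x - a s).card = 3 * q)
    (c : Fin k → (∀ t, ZMod (p ^ hvec t)) × (∀ t, ZMod (p ^ hvec t)))
    (hzero : ∑ s, c s = 0) :
    ∃ I : Finset (Fin k), (∑ s ∈ I, c s) = 0 ∧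
      ∑ s ∈ I, (1 : ℚ) / (n s : ℚ) = q := by
  have hqpos : 0 < q := by omega
  have hk : 0 < k := by
    rcases Nat.eq_zero_or_pos k with rfl | hk
    · have := hcover 0
      simp at this
      omega
    · exact hk
  have (t : Fin l) : NeZero (p ^ hvec t) := ⟨pow_ne_zero _ hp.ne_zero⟩
  have htotal := sum_reciprocal_of_exact_cover a n hn hcover
  obtain ⟨J, hJ, hJ0, hb, M, hM, y, rfl⟩ :=
    exists_nonempty_zero_sum_of_cover (τ := Fin l ⊕ Fin l) hp (Sum.elim hvec hvec) e a n hn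
      (fun x => by rw [hcover x, ← hq]; simp; omega)
      (Sum.elim (fun t s => ((c s).1 t).val) fun t s => ((c s).2 t).val) ⟨0, hk⟩
  have hc : ∑ s ∈ J, c s = 0 := by
    ext t
    · have : ((∑ s ∈ J, ((c s).1 t).val : ℕ) : ZMod (p ^ hvec t)) = 0 :=
        (ZMod.natCast_eq_zero_iff _ _).mpr (hb (Sum.inl t))
      simp_rw [Nat.cast_sum, ZMod.natCast_zmod_val] at this
      simpa [Prod.fst_sum] using this
    · have : ((∑ s ∈ J, ((c s).2 t).val : ℕ) : ZMod (p ^ hvec t)) = 0 :=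
        (ZMod.natCast_eq_zero_iff _ _).mpr (hb (Sum.inr t))
      simp_rw [Nat.cast_sum, ZMod.natCast_zmod_val] at this
      simpa [Prod.snd_sum] using this
  have hpos : ∀ s, (0 : ℚ) < 1 / n s := fun s => by
    have := hn s
    positivity
  have hsplit := Finset.sum_add_sum_compl J fun s => (1 : ℚ) / n s
  have hJpos : 0 < ∑ s ∈ J, (1 : ℚ) / n s := Finset.sum_pos (fun s _ => hpos s) hJ
  have hJcpos : 0 < ∑ s ∈ Jᶜ, (1 : ℚ) / n s :=
    Finset.sum_pos (fun s _ => hpos s) ⟨⟨0, hk⟩, by simpa using hJ0⟩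
  rw [← hq] at hM
  rw [htotal] at hsplit
  have hlow : 0 < q * y := by
    rw [hM] at hJpos
    exact_mod_cast hJpos
  have hhigh : q * y < q * 3 := by
    have : ((q * y : ℕ) : ℚ) < ((3 * q : ℕ) : ℚ) := by linarith
    rw [mul_comm q 3]
    exact_mod_cast this
  have hy0 : 0 < y := Nat.pos_of_mul_pos_left hlow
  have hy3 : y < 3 := Nat.lt_of_mul_lt_mul_left hhigh
  interval_cases y
  · exact ⟨J, hc, by simpa using hM⟩
  · refine ⟨Jᶜ, ?_, ?_⟩
    · have := Finset.sum_add_sum_compl J c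
      rwa [hc, zero_add, hzero] at this
    · push_cast at hM hsplit
      linarith
end

section
/- Let p be a prime, G an abelian p-group, h, Δ ∈ ℕ, and suppose A = {a_s(n_s)}_{s=1}^k is a (d*(G) + p^h + Δ)-cover of ℤ. Let m_1,...,m_k ∈ ℤ, c, c_1,...,c_k ∈ G, α ∈ ℚ, and set 𝓘 = {I ⊆ {1,...,k} : Σ_{s∈I} c_s = c and Σ_{s∈I} m_s/n_s ∈ α + p^h ℤ}. Let P(x_1,...,x_k) ∈ ℚ[x_1,...,x_k] have total degree at most d ∈ ℤ^+ and satisfy P([1∈I],...,[k∈I]) ∈ ℤ for every I ⊆ {1,...,k} with Σ_{s∈I} m_s/n_s − α ∈ ℤ. Then either |{P([1∈I],...,[k∈I]) mod p : I ∈ 𝓘}| > 1 + Δ/d, or else both |{I ∈ 𝓘 : p divides P([1∈I],...,[k∈I])}| ≠ 1 and Σ_{I∈𝓘, p | P([1∈I],...,[k∈I])} (−1)^{|I|} e^{2πi Σ_{s∈I} a_s m_s/n_s} ≡ 0 (mod p) in the ring of algebraic integers. -/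
section CoverSums

open Finset

/-- The additive character `r ↦ e^{2πir}` on the rationals. -/
noncomputable def expTwoPi (r : ℚ) : ℂ := Complex.exp (2 * Real.pi * Complex.I * (r : ℂ))

lemma expTwoPi_zero : expTwoPi 0 = 1 := by simp [expTwoPi]

lemma expTwoPi_add (r s : ℚ) : expTwoPi (r + s) = expTwoPi r * expTwoPi s := by
  simp [expTwoPi, mul_add, Complex.exp_add]

lemma expTwoPi_sum {ι : Type*} (I : Finset ι) (f : ι → ℚ) :
    expTwoPi (∑ s ∈ I, f s) = ∏ s ∈ I, expTwoPi (f s) := by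
  simp [expTwoPi, mul_sum, Complex.exp_sum]

lemma expTwoPi_natCast_mul (N : ℕ) (r : ℚ) : expTwoPi (N * r) = expTwoPi r ^ N := by
  simp only [expTwoPi, ← Complex.exp_nat_mul]
  push_cast
  ring_nf

lemma expTwoPi_eq_one_iff (r : ℚ) : expTwoPi r = 1 ↔ ∃ z : ℤ, r = z := by
  rw [expTwoPi, Complex.exp_eq_one_iff]
  refine exists_congr fun z => ?_
  rw [mul_comm (z : ℂ), mul_right_inj' Complex.two_pi_I_ne_zero]
  exact_mod_cast Iff.rfl

lemma expTwoPi_intCast (z : ℤ) : expTwoPi z = 1 := (expTwoPi_eq_one_iff _).2 ⟨z, rfl⟩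

lemma isIntegral_expTwoPi (r : ℚ) : IsIntegral ℤ (expTwoPi r) := by
  refine IsIntegral.of_pow r.den_pos ?_
  rw [← expTwoPi_natCast_mul, Rat.den_mul_eq_num, expTwoPi_intCast]
  exact isIntegral_one

open scoped Classical in
lemma sum_range_expTwoPi (N : ℕ) (r : ℚ) (hN : ∃ z : ℤ, N * r = z) :
    ∑ x ∈ range N, expTwoPi (x * r) = if ∃ z : ℤ, r = z then (N : ℂ) else 0 := by
  simp only [expTwoPi_natCast_mul]
  split_ifs with hr
  · simp [(expTwoPi_eq_one_iff r).2 hr]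
  · have h1 : expTwoPi r ≠ 1 := fun h => hr ((expTwoPi_eq_one_iff r).1 h)
    rw [geom_sum_eq h1, ← expTwoPi_natCast_mul, (expTwoPi_eq_one_iff _).2 hN]
    simp

lemma sum_superset_prod_eq_zero {ι : Type*} [Fintype ι] [DecidableEq ι] (g : ι → ℂ)
    (J : Finset ι) (hg : ∃ s ∉ J, g s = 1) :
    ∑ I : Finset ι, (if J ⊆ I then (-1 : ℂ) ^ I.card * ∏ s ∈ I, g s else 0) = 0 := by
  have key := prod_add (fun s => -g s) (fun s => if s ∈ J then (0 : ℂ) else 1) univ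
  obtain ⟨s, hs, hgs⟩ := hg
  rw [prod_eq_zero (mem_univ s) (by simp [hs, hgs]), powerset_univ] at key
  refine Eq.trans (sum_congr rfl fun I _ => ?_) key.symm
  rw [prod_neg]
  split_ifs with hJ
  · rw [prod_eq_one (s := univ \ I), mul_one]
    intro t ht
    exact if_neg fun h => (mem_sdiff.1 ht).2 (hJ h)
  · obtain ⟨t, htJ, htI⟩ := not_subset.1 hJ
    have htI' : t ∈ univ \ I := mem_sdiff.2 ⟨mem_univ t, htI⟩
    have hz : ∏ i ∈ univ \ I, (if i ∈ J then (0 : ℂ) else 1) = 0 :=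
      prod_eq_zero htI' (by simp [htJ])
    rw [hz, mul_zero]

open scoped Classical in
lemma sum_superset_expTwoPi_eq_zero {ι : Type*} [Fintype ι] [DecidableEq ι] (a m : ι → ℤ)
    (n : ι → ℕ) (hn : ∀ s, 0 < n s) (α : ℚ) (J : Finset ι)
    (hJ : ∀ x : ℤ, J.card < #{s : ι | (n s : ℤ) ∣ x - a s}) :
    ∑ I : Finset ι with ∃ z : ℤ, ∑ s ∈ I, (m s : ℚ) / (n s : ℚ) - α = z,
      (if J ⊆ I then (-1 : ℂ) ^ I.card * expTwoPi (∑ s ∈ I, (a s * m s : ℚ) / (n s : ℚ))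
        else 0) = 0 := by
  set N : ℕ := α.den * ∏ s, n s with hNdef
  have hN0 : N ≠ 0 := mul_ne_zero α.den_nz (prod_ne_zero_iff.2 fun s _ => (hn s).ne')
  have hNα : ∃ z : ℤ, (N : ℚ) * α = z := by
    refine ⟨(∏ s, (n s : ℤ)) * α.num, ?_⟩
    rw [hNdef]
    push_cast
    rw [← Rat.den_mul_eq_num]
    ring
  have hNs : ∀ s, ∃ z : ℤ, (N : ℚ) * ((m s : ℚ) / (n s : ℚ)) = z := by
    intro s
    obtain ⟨q, hq⟩ : n s ∣ N := Dvd.dvd.mul_left (dvd_prod_of_mem n (mem_univ s)) _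
    refine ⟨q * m s, ?_⟩
    have : (n s : ℚ) ≠ 0 := by exact_mod_cast (hn s).ne'
    rw [hq]
    push_cast
    field_simp
  choose w hw using hNs
  obtain ⟨v, hv⟩ := hNα
  have hNI : ∀ I : Finset ι, ∃ z : ℤ, (N : ℚ) * (∑ s ∈ I, (m s : ℚ) / (n s : ℚ) - α) = z := by
    intro I
    refine ⟨∑ s ∈ I, w s - v, ?_⟩
    rw [mul_sub, mul_sum, hv]
    push_cast
    simp [hw]
  have hcast : (N : ℂ) ≠ 0 := by exact_mod_cast hN0
  refine (mul_eq_zero.1 ?_).resolve_left hcast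
  have hx : ∀ x : ℕ, ∑ I : Finset ι, (if J ⊆ I then (-1 : ℂ) ^ I.card *
      ∏ s ∈ I, expTwoPi ((a s * m s : ℚ) / n s + x * ((m s : ℚ) / n s)) else 0) = 0 := by
    intro x
    refine sum_superset_prod_eq_zero _ J ?_
    obtain ⟨s, hs, hsJ⟩ := exists_mem_notMem_of_card_lt_card (hJ (-x))
    refine ⟨s, hsJ, (expTwoPi_eq_one_iff _).2 ?_⟩
    obtain ⟨q, hq⟩ := (mem_filter.1 hs).2
    refine ⟨-q * m s, ?_⟩
    have hne : (n s : ℚ) ≠ 0 := by exact_mod_cast (hn s).ne'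
    have hq' : (-x - a s : ℚ) = n s * q := by exact_mod_cast hq
    push_cast
    field_simp
    linear_combination (-(m s : ℚ)) * hq'
  calc (N : ℂ) * _ = ∑ I : Finset ι, ∑ x ∈ range N, expTwoPi (-(x * α)) *
        (if J ⊆ I then (-1 : ℂ) ^ I.card *
          ∏ s ∈ I, expTwoPi ((a s * m s : ℚ) / n s + x * ((m s : ℚ) / n s)) else 0) := by
        rw [sum_filter, mul_sum]
        refine sum_congr rfl fun I _ => ?_
        have : ∀ x : ℕ, expTwoPi (-(x * α)) * (if J ⊆ I then (-1 : ℂ) ^ I.card *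
            ∏ s ∈ I, expTwoPi ((a s * m s : ℚ) / n s + x * ((m s : ℚ) / n s)) else 0) =
            expTwoPi (x * (∑ s ∈ I, (m s : ℚ) / (n s : ℚ) - α)) * (if J ⊆ I then (-1 : ℂ) ^ I.card *
              expTwoPi (∑ s ∈ I, (a s * m s : ℚ) / (n s : ℚ)) else 0) := by
          intro x
          split_ifs
          · rw [← expTwoPi_sum, sum_add_distrib, ← mul_sum, expTwoPi_add, mul_sub, sub_eq_add_neg,
              expTwoPi_add]
            ring
          · simp
        simp only [this]
        rw [← sum_mul, sum_range_expTwoPi N _ (hNI I)]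
        split_ifs <;> simp
    _ = 0 := by
        rw [sum_comm]
        exact sum_eq_zero fun x _ => by rw [← mul_sum, hx, mul_zero]

lemma MvPolynomial.eval_indicator_eq_sum {ι : Type*} [DecidableEq ι] (Q : MvPolynomial ι ℚ)
    (I : Finset ι) :
    eval (fun s => if s ∈ I then (1 : ℚ) else 0) Q =
      ∑ u ∈ Q.support, Q.coeff u * if u.support ⊆ I then 1 else 0 := by
  rw [eval_eq]
  refine sum_congr rfl fun u _ => ?_
  congr 1
  split_ifs with hu
  · exact prod_eq_one fun s hs => by simp [hu hs]
  · obtain ⟨t, htu, htI⟩ := not_subset.1 hu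
    exact prod_eq_zero htu (by simp [htI, Finsupp.mem_support_iff.1 htu])

open scoped Classical in
/-- A polynomial of degree less than the covering multiplicity has vanishing signed weighted sum
over the subsets `I` with `∑_{s ∈ I} m_s / n_s ∈ α + ℤ`. -/
lemma sum_eval_mul_expTwoPi_eq_zero {ι : Type*} [Fintype ι] [DecidableEq ι] (a m : ι → ℤ)
    (n : ι → ℕ) (hn : ∀ s, 0 < n s) (α : ℚ) (Q : MvPolynomial ι ℚ)
    (hQ : ∀ x : ℤ, Q.totalDegree < #{s : ι | (n s : ℤ) ∣ x - a s}) :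
    ∑ I : Finset ι with ∃ z : ℤ, ∑ s ∈ I, (m s : ℚ) / (n s : ℚ) - α = z,
      ((MvPolynomial.eval (fun s => if s ∈ I then (1 : ℚ) else 0) Q : ℚ) : ℂ) *
        ((-1 : ℂ) ^ I.card * expTwoPi (∑ s ∈ I, (a s * m s : ℚ) / (n s : ℚ))) = 0 := by
  simp only [MvPolynomial.eval_indicator_eq_sum]
  push_cast
  simp only [sum_mul]
  rw [sum_comm]
  refine sum_eq_zero fun u hu => ?_
  have hcard : u.support.card ≤ Q.totalDegree := by
    refine le_trans ?_ (MvPolynomial.le_totalDegree hu)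
    rw [Finsupp.sum, card_eq_sum_ones]
    exact sum_le_sum fun s hs => Nat.one_le_iff_ne_zero.2 (Finsupp.mem_support_iff.1 hs)
  have key := sum_superset_expTwoPi_eq_zero a m n hn α u.support
    fun x => hcard.trans_lt (hQ x)
  have := congrArg (fun y => ((Q.coeff u : ℚ) : ℂ) * y) key
  rw [mul_zero, mul_sum] at this
  rw [← this]
  refine sum_congr rfl fun I _ => ?_
  split_ifs <;> simp

lemma Ring.choose_int_add_prime_pow_modEq {p : ℕ} (hp : p.Prime) (h r : ℕ) (hr : r < p ^ h)
    (x : ℤ) : ((Ring.choose (x + (p ^ h : ℕ)) r : ℤ) : ZMod p) = (Ring.choose x r : ℤ) := by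
  rw [Ring.add_choose_eq _ (Commute.all _ _), Int.cast_sum,
    sum_eq_single_of_mem (r, 0) (by simp)]
  · simp
  · rintro ⟨i, j⟩ hij hne
    rw [HasAntidiagonal.mem_antidiagonal] at hij
    have hj0 : j ≠ 0 := by rintro rfl; simp_all
    have hdvd : p ∣ (p ^ h).choose j := hp.dvd_choose_pow hj0 (by grind)
    have : (((p ^ h).choose j : ℕ) : ZMod p) = 0 := (ZMod.natCast_eq_zero_iff _ _).2 hdvd
    rw [Ring.choose_natCast, Int.cast_mul, Int.cast_natCast, this, mul_zero]

lemma Ring.choose_int_add_prime_pow_mul_eq {p : ℕ} (hp : p.Prime) (h r : ℕ) (hr : r < p ^ h)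
    (x y : ℤ) : ((Ring.choose (x + (p ^ h : ℕ) * y) r : ℤ) : ZMod p) = (Ring.choose x r : ℤ) := by
  induction y using Int.induction_on with
  | zero => simp
  | succ i ih =>
    rw [← ih, ← Ring.choose_int_add_prime_pow_modEq hp h r hr (x + _ * (i : ℤ)), mul_add, mul_one,
      add_assoc]
  | pred i ih =>
    rw [← ih, ← Ring.choose_int_add_prime_pow_modEq hp h r hr]
    ring_nf

lemma Ring.choose_sub_one_prime_pow_sub_one {p : ℕ} (hp : p.Prime) (h : ℕ) (u : ℤ) :
    ((Ring.choose (u - 1) (p ^ h - 1) : ℤ) : ZMod p) = if ((p ^ h : ℕ) : ℤ) ∣ u then 1 else 0 := by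
  have hq : 0 < p ^ h := pow_pos hp.pos h
  generalize hqq : p ^ h = q at *
  have hq' : (0 : ℤ) < q := by exact_mod_cast hq
  obtain ⟨r, hr⟩ := Int.eq_ofNat_of_zero_le (Int.emod_nonneg (u - 1) hq'.ne')
  have hrq : (r : ℤ) < q := by rw [← hr]; exact Int.emod_lt_of_pos _ hq'
  have hdiv : u - 1 = r + (q : ℤ) * ((u - 1) / q) := by
    rw [← hr]; exact (Int.emod_add_mul_ediv _ _).symm
  have hstep := Ring.choose_int_add_prime_pow_mul_eq hp h (q - 1) (by omega) r ((u - 1) / q)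
  rw [hqq, ← hdiv] at hstep
  rw [hstep, Ring.choose_natCast]
  have hiff : (q : ℤ) ∣ u ↔ r = q - 1 := by
    have : u = ((r : ℤ) + 1) + q * ((u - 1) / q) := by linarith
    rw [this, Int.dvd_add_left (Dvd.intro _ rfl)]
    constructor
    · intro hd
      have := Int.le_of_dvd (by omega) hd
      omega
    · intro hd
      exact ⟨1, by omega⟩
  by_cases hu : r = q - 1
  · rw [if_pos (hiff.2 hu), hu]; simp
  · rw [if_neg (mt hiff.1 hu), Nat.choose_eq_zero_of_lt (by omega)]; simp

/-- `x` is an integer whose reduction mod `p` is `v`. -/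
def ReducesTo (p : ℕ) (x : ℚ) (v : ZMod p) : Prop := ∃ z : ℤ, x = z ∧ (z : ZMod p) = v

lemma ReducesTo.mul {p : ℕ} {x y : ℚ} {v w : ZMod p} (hx : ReducesTo p x v)
    (hy : ReducesTo p y w) : ReducesTo p (x * y) (v * w) := by
  obtain ⟨z, rfl, rfl⟩ := hx
  obtain ⟨z', rfl, rfl⟩ := hy
  exact ⟨z * z', by push_cast; rfl, by push_cast; rfl⟩

lemma ReducesTo.prod {p : ℕ} {ι : Type*} (T : Finset ι) {x : ι → ℚ} {v : ι → ZMod p}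
    (hx : ∀ t ∈ T, ReducesTo p (x t) (v t)) :
    ReducesTo p (∏ t ∈ T, x t) (∏ t ∈ T, v t) := by
  classical
  induction T using Finset.induction_on with
  | empty => exact ⟨1, by simp, by simp⟩
  | insert t T ht ih =>
    rw [prod_insert ht, prod_insert ht]
    exact (hx t (mem_insert_self _ _)).mul (ih fun s hs => hx s (mem_insert_of_mem hs))

/-- The polynomial `binom(L - 1, r)`. -/
noncomputable def choosePred {ι : Type*} (L : MvPolynomial ι ℚ) (r : ℕ) : MvPolynomial ι ℚ :=
  MvPolynomial.C ((r.factorial : ℚ)⁻¹) * ∏ j ∈ range r, (L - MvPolynomial.C (1 + j : ℚ))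

lemma totalDegree_choosePred_le {ι : Type*} (L : MvPolynomial ι ℚ) (hL : L.totalDegree ≤ 1)
    (r : ℕ) : (choosePred L r).totalDegree ≤ r := by
  refine (MvPolynomial.totalDegree_mul _ _).trans ?_
  rw [MvPolynomial.totalDegree_C, zero_add]
  refine (MvPolynomial.totalDegree_finsetProd _ _).trans ?_
  calc _ ≤ ∑ j ∈ range r, 1 := sum_le_sum fun j _ => by
        refine (MvPolynomial.totalDegree_sub _ _).trans ?_
        rw [MvPolynomial.totalDegree_C]
        exact max_le hL zero_le_one
    _ = r := by simp

lemma eval_choosePred {ι : Type*} (L : MvPolynomial ι ℚ) (r : ℕ) (x : ι → ℚ) (u : ℤ)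
    (hu : MvPolynomial.eval x L = u) :
    MvPolynomial.eval x (choosePred L r) = (Ring.choose (u - 1) r : ℤ) := by
  have key := Ring.descPochhammer_eq_factorial_smul_choose (u - 1) r
  rw [← Polynomial.eval_eq_smeval, descPochhammer_eval_eq_prod_range] at key
  have key' : ∏ j ∈ range r, ((u : ℚ) - (1 + j)) = r.factorial * (Ring.choose (u - 1) r : ℤ) := by
    have := congrArg (fun z : ℤ => (z : ℚ)) key
    simpa [sub_sub] using this
  simp only [choosePred, map_mul, map_prod, map_sub, MvPolynomial.eval_C, hu]
  rw [key', inv_mul_cancel_left₀ (by exact_mod_cast r.factorial_ne_zero)]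

lemma reducesTo_eval_choosePred {ι : Type*} {p : ℕ} (hp : p.Prime) (h : ℕ)
    (L : MvPolynomial ι ℚ) (x : ι → ℚ) (u : ℤ) (hu : MvPolynomial.eval x L = u) :
    ReducesTo p (MvPolynomial.eval x (choosePred L (p ^ h - 1)))
      (if ((p ^ h : ℕ) : ℤ) ∣ u then 1 else 0) :=
  ⟨_, eval_choosePred L _ x u hu, Ring.choose_sub_one_prime_pow_sub_one hp h u⟩

/-- The affine polynomial `∑ f_s x_s - b`. -/
noncomputable def affinePoly {ι : Type*} [Fintype ι] (f : ι → ℚ) (b : ℚ) : MvPolynomial ι ℚ :=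
  ∑ s, MvPolynomial.C (f s) * MvPolynomial.X s - MvPolynomial.C b

lemma totalDegree_affinePoly_le {ι : Type*} [Fintype ι] (f : ι → ℚ) (b : ℚ) :
    (affinePoly f b).totalDegree ≤ 1 := by
  refine (MvPolynomial.totalDegree_sub _ _).trans (max_le ?_ (by simp))
  refine MvPolynomial.totalDegree_finsetSum_le fun s _ => ?_
  refine (MvPolynomial.totalDegree_mul _ _).trans ?_
  simp

lemma eval_affinePoly {ι : Type*} [Fintype ι] [DecidableEq ι] (f : ι → ℚ) (b : ℚ) (I : Finset ι) :
    MvPolynomial.eval (fun s => if s ∈ I then (1 : ℚ) else 0) (affinePoly f b) =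
      ∑ s ∈ I, f s - b := by
  simp [affinePoly]

lemma eq_prime_mul_isIntegral_of_sum_eq_zero {ι : Type*} {p : ℕ} (hp : p.Prime) (T : Finset ι)
    (good : ι → Prop) [DecidablePred good] (C : ℤ) (hC : (C : ZMod p) ≠ 0) (q : ι → ℚ)
    (hq : ∀ i ∈ T, ReducesTo p (q i) (if good i then (C : ZMod p) else 0)) (e : ι → ℂ)
    (he : ∀ i, IsIntegral ℤ (e i)) (hsum : ∑ i ∈ T, (q i : ℂ) * e i = 0) :
    ∃ ω : ℂ, IsIntegral ℤ ω ∧ ∑ i ∈ T with good i, e i = p * ω := by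
  have hw : ∀ i ∈ T, ∃ w : ℤ, (if good i then (C : ℂ) else 0) - (q i : ℂ) = p * w := by
    intro i hi
    obtain ⟨z, hz, hzp⟩ := hq i hi
    have : (((if good i then C else 0) - z : ℤ) : ZMod p) = 0 := by
      push_cast
      rw [hzp]
      split_ifs <;> simp
    obtain ⟨w, hw⟩ := (ZMod.intCast_zmod_eq_zero_iff_dvd _ p).1 this
    refine ⟨w, ?_⟩
    rw [hz]
    have := congrArg (fun y : ℤ => (y : ℂ)) hw
    push_cast at this ⊢
    exact this
  choose! w hw using hw
  have hcop : IsCoprime C (p : ℤ) := by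
    rw [isCoprime_comm, (Nat.prime_iff_prime_int.1 hp).coprime_iff_not_dvd]
    exact fun hd => hC ((ZMod.intCast_zmod_eq_zero_iff_dvd _ p).2 hd)
  obtain ⟨x, y, hxy⟩ := hcop
  have hxy' : (x : ℂ) * C + y * p = 1 := by exact_mod_cast hxy
  have hint : ∀ z : ℤ, IsIntegral ℤ (z : ℂ) := fun z => isIntegral_algebraMap (R := ℤ) (x := z)
  have hCS : (C : ℂ) * ∑ i ∈ T with good i, e i = p * ∑ i ∈ T, (w i : ℂ) * e i := by
    rw [← sub_zero (_ * _), ← hsum, sum_filter, mul_sum, mul_sum, ← sum_sub_distrib]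
    refine sum_congr rfl fun i hi => ?_
    rw [← mul_assoc, ← hw i hi]
    split_ifs <;> ring
  refine ⟨x * ∑ i ∈ T, (w i : ℂ) * e i + y * ∑ i ∈ T with good i, e i, ?_, ?_⟩
  · exact ((hint x).mul (IsIntegral.sum _ fun i _ => (hint _).mul (he i))).add
      ((hint y).mul (IsIntegral.sum _ fun i _ => he i))
  · linear_combination (-(∑ i ∈ T with good i, e i)) * hxy' + (x : ℂ) * hCS

lemma neg_one_pow_mul_expTwoPi_ne_prime_mul {p : ℕ} (hp : p.Prime) (j : ℕ) (r : ℚ) (ω : ℂ)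
    (hω : IsIntegral ℤ ω) : (-1 : ℂ) ^ j * expTwoPi r ≠ p * ω := by
  intro heq
  have hpQ : (p : ℚ) ≠ 0 := by exact_mod_cast hp.ne_zero
  have hr : expTwoPi (-r) * expTwoPi r = 1 := by
    rw [← expTwoPi_add, neg_add_cancel, expTwoPi_zero]
  have hs : (-1 : ℂ) ^ j * (-1) ^ j = 1 := by rw [← mul_pow]; simp
  have h1 : (p : ℂ) * ((-1 : ℂ) ^ j * expTwoPi (-r) * ω) = 1 := by
    linear_combination (-(-1 : ℂ) ^ j * expTwoPi (-r)) * heq +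
      expTwoPi (-r) * expTwoPi r * hs + hr
  have h2 : IsIntegral ℤ (algebraMap ℚ ℂ (p : ℚ)⁻¹) := by
    have : algebraMap ℚ ℂ (p : ℚ)⁻¹ = (-1 : ℂ) ^ j * expTwoPi (-r) * ω := by
      rw [map_inv₀, map_natCast]
      exact (eq_inv_of_mul_eq_one_right h1).symm
    rw [this]
    exact ((isIntegral_one.neg.pow j).mul (isIntegral_expTwoPi _)).mul hω
  obtain ⟨z, hz⟩ := IsIntegrallyClosed.isIntegral_iff.1
    ((isIntegral_algebraMap_iff (algebraMap ℚ ℂ).injective).1 h2)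
  have h3 : (p : ℚ) * z = 1 := by
    rw [show (z : ℚ) = (p : ℚ)⁻¹ from hz, mul_inv_cancel₀ hpQ]
  have h4 : (p : ℤ) * z = 1 := by exact_mod_cast h3
  exact (Nat.prime_iff_prime_int.1 hp).not_dvd_one ⟨z, h4.symm⟩

lemma sum_eq_iff_forall_dvd {ι τ : Type*} {N : τ → ℕ} [∀ t, NeZero (N t)]
    (c : ι → ∀ t, ZMod (N t)) (c₀ : ∀ t, ZMod (N t)) (I : Finset ι) :
    ∑ s ∈ I, c s = c₀ ↔
      ∀ t, (N t : ℤ) ∣ ∑ s ∈ I, ((c s t).val : ℤ) - ((c₀ t).val : ℤ) := by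
  rw [funext_iff]
  refine forall_congr' fun t => ?_
  rw [← ZMod.intCast_zmod_eq_zero_iff_dvd, Finset.sum_apply]
  push_cast
  simp [sub_eq_zero]

end CoverSums

open scoped Classical in
/-- **Theorem 3.1 (general theorem).**
Let `G = ⨁_t ℤ/p^{hvec t}ℤ` with `d*(G) = ∑_t (p^{hvec t}-1)`, and let
`{a s (n s)}_{s=1}^k` be a `(d*(G)+p^h+Δ)`-cover of `ℤ`.  With
`𝓘 = {I : ∑_{s∈I} c_s = c ∧ ∑_{s∈I} m_s/n_s ∈ α + p^h ℤ}` and a rational polynomial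
`P` of total degree at most `d` taking integer values `P([1∈I],…,[k∈I])` whenever
`∑_{s∈I} m_s/n_s − α ∈ ℤ` (for `I ∈ 𝓘` this integer value is `(P([1∈I],…)).num`),
either `|{P([1∈I],…) mod p : I ∈ 𝓘}| > 1 + Δ/d`, or else
`|{I ∈ 𝓘 : p ∣ P([1∈I],…)}| ≠ 1` and
`∑_{I∈𝓘, p ∣ P([1∈I],…)} (−1)^{|I|} e^{2πi ∑_{s∈I} a_s m_s/n_s}` is `p` times an
algebraic integer. -/
theorem stmt9 (p : ℕ) (hp : p.Prime) (l : ℕ) (hvec : Fin l → ℕ) (h Δ : ℕ)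
    (k : ℕ) (a : Fin k → ℤ) (n : Fin k → ℕ) (hn : ∀ s, 0 < n s)
    (hcover : ∀ x : ℤ,
      (∑ t, (p ^ hvec t - 1)) + p ^ h + Δ ≤
        (Finset.univ.filter fun s : Fin k => (n s : ℤ) ∣ x - a s).card)
    (m : Fin k → ℤ) (c : Fin k → (∀ t, ZMod (p ^ hvec t)))
    (c₀ : ∀ t, ZMod (p ^ hvec t)) (α : ℚ)
    (P : MvPolynomial (Fin k) ℚ) (d : ℕ) (hd : 0 < d) (hdeg : P.totalDegree ≤ d)
    (hPint : ∀ I : Finset (Fin k),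
      (∃ z : ℤ, ∑ s ∈ I, (m s : ℚ) / (n s : ℚ) - α = z) →
      ∃ z : ℤ, MvPolynomial.eval (fun s => if s ∈ I then (1 : ℚ) else 0) P = z) :
    (1 + (Δ : ℚ) / (d : ℚ) <
      ({r : ZMod p | ∃ I : Finset (Fin k),
          ((∑ s ∈ I, c s) = c₀ ∧
            (∃ z : ℤ, ∑ s ∈ I, (m s : ℚ) / (n s : ℚ) = α + (p : ℚ) ^ h * z)) ∧
          ((MvPolynomial.eval (fun s => if s ∈ I then (1 : ℚ) else 0) P).num : ZMod p)
            = r}.ncard : ℚ)) ∨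
    ({I : Finset (Fin k) |
        ((∑ s ∈ I, c s) = c₀ ∧
          (∃ z : ℤ, ∑ s ∈ I, (m s : ℚ) / (n s : ℚ) = α + (p : ℚ) ^ h * z)) ∧
        (p : ℤ) ∣ (MvPolynomial.eval (fun s => if s ∈ I then (1 : ℚ) else 0) P).num}.ncard ≠ 1 ∧
      ∃ ω : ℂ, IsIntegral ℤ ω ∧
        ∑ I ∈ Finset.univ.filter (fun I : Finset (Fin k) =>
            ((∑ s ∈ I, c s) = c₀ ∧
              (∃ z : ℤ, ∑ s ∈ I, (m s : ℚ) / (n s : ℚ) = α + (p : ℚ) ^ h * z)) ∧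
            (p : ℤ) ∣ (MvPolynomial.eval (fun s => if s ∈ I then (1 : ℚ) else 0) P).num),
          (-1 : ℂ) ^ I.card *
            Complex.exp (2 * Real.pi * Complex.I *
              ((∑ s ∈ I, (a s * m s : ℚ) / (n s : ℚ) : ℚ) : ℂ))
          = (p : ℂ) * ω) := by
  set eI : Finset (Fin k) → Fin k → ℚ := fun I s => if s ∈ I then (1 : ℚ) else 0
  have hpf : Fact p.Prime := ⟨hp⟩
  set good : Finset (Fin k) → Prop := fun I => (∑ s ∈ I, c s) = c₀ ∧
    (∃ z : ℤ, ∑ s ∈ I, (m s : ℚ) / (n s : ℚ) = α + (p : ℚ) ^ h * z)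
  set R : Set (ZMod p) := {r | ∃ I : Finset (Fin k), good I ∧
    ((MvPolynomial.eval (eI I) P).num : ZMod p) = r}
  rw [or_iff_not_imp_left, not_lt]
  intro hRcard
  by_cases h0 : (0 : ZMod p) ∈ R
  swap
  · have hempty : ∀ I, ¬ (good I ∧ (p : ℤ) ∣ (MvPolynomial.eval (eI I) P).num) := fun I hI =>
      h0 ⟨I, hI.1, (ZMod.intCast_zmod_eq_zero_iff_dvd _ p).2 hI.2⟩
    refine ⟨?_, 0, isIntegral_zero, ?_⟩
    · have hset : {I | good I ∧ (p : ℤ) ∣ (MvPolynomial.eval (eI I) P).num} = ∅ :=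
        Set.eq_empty_of_forall_notMem hempty
      exact fun hone => zero_ne_one ((Set.ncard_empty _).symm.trans (hset ▸ hone))
    · rw [Finset.filter_false_of_mem fun I _ => hempty I]
      simp
  set T : Finset (ZMod p) := R.toFinset.erase 0 with hT
  have hTcard : T.card * d ≤ Δ := by
    rw [Set.ncard_eq_toFinset_card'] at hRcard
    have h1 : T.card + 1 = R.toFinset.card :=
      Finset.card_erase_add_one (Set.mem_toFinset.2 h0)
    rw [← h1] at hRcard
    push_cast at hRcard
    have hd' : (0 : ℚ) < d := by exact_mod_cast hd
    have h2 : (T.card : ℚ) ≤ Δ / d := by linarith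
    rw [le_div_iff₀ hd'] at h2
    exact_mod_cast h2
  have hNe : ∀ t, NeZero (p ^ hvec t) := fun t => ⟨pow_ne_zero _ hp.ne_zero⟩
  set Q₁ : MvPolynomial (Fin k) ℚ := ∏ t, choosePred
    (affinePoly (fun s => (((c s t).val : ℕ) : ℚ)) ((c₀ t).val : ℕ)) (p ^ hvec t - 1) with hQ₁
  set Q₂ : MvPolynomial (Fin k) ℚ :=
    choosePred (affinePoly (fun s => (m s : ℚ) / n s) α) (p ^ h - 1) with hQ₂
  set Q₃ : MvPolynomial (Fin k) ℚ := ∏ r ∈ T, (P - MvPolynomial.C ((r.val : ℕ) : ℚ)) with hQ₃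
  have hdeg₁ : Q₁.totalDegree ≤ ∑ t, (p ^ hvec t - 1) :=
    (MvPolynomial.totalDegree_finsetProd _ _).trans <| Finset.sum_le_sum fun t _ =>
      totalDegree_choosePred_le _ (totalDegree_affinePoly_le _ _) _
  have hdeg₂ : Q₂.totalDegree ≤ p ^ h - 1 :=
    totalDegree_choosePred_le _ (totalDegree_affinePoly_le _ _) _
  have hdeg₃ : Q₃.totalDegree ≤ Δ := by
    refine (MvPolynomial.totalDegree_finsetProd _ _).trans (le_trans ?_ hTcard)
    rw [← smul_eq_mul, ← Finset.sum_const]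
    refine Finset.sum_le_sum fun r _ => ?_
    refine (MvPolynomial.totalDegree_sub _ _).trans ?_
    rw [MvPolynomial.totalDegree_C]
    exact max_le hdeg d.zero_le
  have hdegQ : ∀ x : ℤ, (Q₁ * Q₂ * Q₃).totalDegree <
      (Finset.univ.filter fun s : Fin k => (n s : ℤ) ∣ x - a s).card := by
    intro x
    refine lt_of_lt_of_le ?_ (hcover x)
    have := MvPolynomial.totalDegree_mul (Q₁ * Q₂) Q₃
    have := MvPolynomial.totalDegree_mul Q₁ Q₂
    have : 0 < p ^ h := pow_pos hp.pos h
    omega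
  set C : ℤ := ∏ r ∈ T, (0 - (r.val : ℤ)) with hC
  have hCp : (C : ZMod p) = ∏ r ∈ T, (0 - r) := by
    rw [hC]
    push_cast
    exact Finset.prod_congr rfl fun r _ => by rw [ZMod.natCast_zmod_val]
  have hC0 : (C : ZMod p) ≠ 0 := by
    rw [hCp, Finset.prod_ne_zero_iff]
    intro r hr
    rw [zero_sub, neg_ne_zero]
    exact Finset.ne_of_mem_erase hr
  have hred : ∀ I ∈ Finset.univ.filter (fun I : Finset (Fin k) =>
      ∃ z : ℤ, ∑ s ∈ I, (m s : ℚ) / (n s : ℚ) - α = z),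
      ReducesTo p (MvPolynomial.eval (eI I) (Q₁ * Q₂ * Q₃))
        (if good I ∧ (p : ℤ) ∣ (MvPolynomial.eval (eI I) P).num then (C : ZMod p) else 0) := by
    intro I hI
    have hI' := (Finset.mem_filter.1 hI).2
    obtain ⟨y, hy⟩ := hPint I hI'
    obtain ⟨u, hu⟩ := hI'
    have hα : (∃ z : ℤ, ∑ s ∈ I, (m s : ℚ) / (n s : ℚ) = α + (p : ℚ) ^ h * z) ↔
        ((p ^ h : ℕ) : ℤ) ∣ u := by
      refine exists_congr fun z => ?_
      rw [← sub_eq_iff_eq_add', hu]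
      exact_mod_cast Iff.rfl
    have hnum : (MvPolynomial.eval (eI I) P).num = y := by rw [hy, Rat.num_intCast]
    have r₁ : ReducesTo p (MvPolynomial.eval (eI I) Q₁)
        (∏ t, if ((p ^ hvec t : ℕ) : ℤ) ∣ ∑ s ∈ I, ((c s t).val : ℤ) - ((c₀ t).val : ℤ)
          then 1 else 0) := by
      rw [hQ₁, map_prod]
      refine ReducesTo.prod _ fun t _ => reducesTo_eval_choosePred hp _ _ _ _ ?_
      refine (eval_affinePoly _ _ I).trans ?_
      push_cast
      rfl
    have r₂ : ReducesTo p (MvPolynomial.eval (eI I) Q₂)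
        (if ((p ^ h : ℕ) : ℤ) ∣ u then 1 else 0) :=
      reducesTo_eval_choosePred hp _ _ _ _ ((eval_affinePoly _ _ I).trans hu)
    have r₃ : ReducesTo p (MvPolynomial.eval (eI I) Q₃) (∏ r ∈ T, ((y : ZMod p) - r)) := by
      rw [hQ₃, map_prod]
      refine ReducesTo.prod _ fun r _ => ⟨y - r.val, ?_, ?_⟩
      · rw [map_sub, hy, MvPolynomial.eval_C]
        push_cast
        rfl
      · push_cast
        rw [ZMod.natCast_zmod_val]
    rw [map_mul, map_mul]
    convert (r₁.mul r₂).mul r₃ using 1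
    by_cases hg : good I
    · have hg' : good I := hg
      obtain ⟨hg₁, hg₂⟩ := hg
      rw [Finset.prod_eq_one fun t _ => if_pos ((sum_eq_iff_forall_dvd c c₀ I).1 hg₁ t),
        if_pos (hα.1 hg₂), one_mul, one_mul, hnum]
      by_cases hyp : (p : ℤ) ∣ y
      · rw [if_pos ⟨hg', hyp⟩, hCp, (ZMod.intCast_zmod_eq_zero_iff_dvd _ p).2 hyp]
      · rw [if_neg fun hh => hyp hh.2]
        symm
        refine Finset.prod_eq_zero (i := (y : ZMod p)) ?_ (sub_self _)
        rw [hT, Finset.mem_erase, Set.mem_toFinset]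
        exact ⟨fun hh => hyp ((ZMod.intCast_zmod_eq_zero_iff_dvd _ p).1 hh), I, hg',
          by rw [hnum]⟩
    · rw [if_neg fun hh => hg hh.1]
      symm
      by_cases hu' : ((p ^ h : ℕ) : ℤ) ∣ u
      · have : ¬ ∑ s ∈ I, c s = c₀ := fun hh => hg ⟨hh, hα.2 hu'⟩
        rw [sum_eq_iff_forall_dvd, not_forall] at this
        obtain ⟨t, ht⟩ := this
        rw [Finset.prod_eq_zero (Finset.mem_univ t) (if_neg ht), zero_mul, zero_mul]
      · rw [if_neg hu', mul_zero, zero_mul]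
  obtain ⟨ω, hω, hsum⟩ := eq_prime_mul_isIntegral_of_sum_eq_zero hp _
    (fun I => good I ∧ (p : ℤ) ∣ (MvPolynomial.eval (eI I) P).num) C hC0 _ hred
    (fun I => (-1 : ℂ) ^ I.card * expTwoPi (∑ s ∈ I, (a s * m s : ℚ) / (n s : ℚ)))
    (fun I => (isIntegral_one.neg.pow _).mul (isIntegral_expTwoPi _))
    (sum_eval_mul_expTwoPi_eq_zero a m n hn α _ hdegQ)
  have hfilter : (Finset.univ.filter (fun I : Finset (Fin k) =>
      ∃ z : ℤ, ∑ s ∈ I, (m s : ℚ) / (n s : ℚ) - α = z)).filter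
        (fun I => good I ∧ (p : ℤ) ∣ (MvPolynomial.eval (eI I) P).num) =
      Finset.univ.filter
        (fun I => good I ∧ (p : ℤ) ∣ (MvPolynomial.eval (eI I) P).num) := by
    ext I
    simp only [Finset.mem_filter, Finset.mem_univ, true_and, and_iff_right_iff_imp]
    rintro ⟨⟨-, z, hz⟩, -⟩
    exact ⟨p ^ h * z, by rw [hz]; push_cast; ring⟩
  rw [hfilter] at hsum
  refine ⟨fun hone => ?_, ω, hω, hsum⟩
  obtain ⟨I, hI⟩ := Set.ncard_eq_one.1 hone
  have hsingle : Finset.univ.filter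
      (fun I => good I ∧ (p : ℤ) ∣ (MvPolynomial.eval (eI I) P).num) = {I} := by
    ext J
    have := Set.ext_iff.1 hI J
    simpa using this
  rw [hsingle, Finset.sum_singleton] at hsum
  exact neg_one_pow_mul_expTwoPi_ne_prime_mul hp _ _ ω hω hsum
end
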